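/- arXiv:1610.06108 — 8 statements merged into one kernel-verified Lean document; each statement's English description precedes it below -/
import Mathlib

section
/- Let S ≥ 1, let x_1,…,x_S, y_1,…,y_S be complex numbers with x_j ≠ y_k for all j,k, and let a_j, b_j, c_j, d_j (1 ≤ j ≤ S) be complex numbers. Then det[ (a_j·d_k − b_j·c_k)/(x_j − y_k) ]_{j,k=1}^S = (−1)^{S(S−1)/2} · (∏_{j,k=1}^S (x_j − y_k))^{−1} · det T, where T is the 2S × 2S complex matrix whose row j (for 1 ≤ j ≤ S) is (x_j^{ℓ−1} a_j)_{ℓ=1}^S followed by (x_j^{ℓ−1} b_j)_{ℓ=1}^S, and whose row S + j (for 1 ≤ j ≤ S) is (y_j^{ℓ−1} c_j)_{ℓ=1}^S followed by (y_j^{ℓ−1} d_j)_{ℓ=1}^S. -/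
open Finset Matrix Polynomial

/-- The Vandermonde determinant squared is, up to sign, the product of all differences. -/
theorem prod_prod_compl_sub_eq_sign_mul_det_vandermonde_sq {R : Type*} [CommRing R] {n : ℕ}
    (y : Fin n → R) :
    ∏ k, ∏ m ∈ {k}ᶜ, (y k - y m) = (-1) ^ (n * (n - 1) / 2) * (vandermonde y).det ^ 2 := by
  have hcard : ∑ i : Fin n, #(Ioi i) = n * (n - 1) / 2 := by
    simp only [Fin.card_Ioi]
    rw [Fin.sum_univ_eq_sum_range (fun i => n - 1 - i) n, Finset.sum_range_reflect (fun i => i) n,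
      Finset.sum_range_id]
  rw [← Finset.prod_prod_Ioi_mul_eq_prod_prod_off_diag (fun m k => y k - y m), det_vandermonde,
    ← hcard, ← Finset.prod_pow_eq_pow_sum, ← Finset.prod_pow, ← Finset.prod_mul_distrib]
  refine Finset.prod_congr rfl fun i _ => ?_
  rw [← Finset.prod_const, ← Finset.prod_pow, ← Finset.prod_mul_distrib]
  exact Finset.prod_congr rfl fun j _ => by ring

/-- The coefficients of the monic polynomials `∏ m ≠ k, (X - y m)`, one per column. -/
noncomputable def nodalCoeff {R : Type*} [CommRing R] {n : ℕ} (y : Fin n → R) :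
    Matrix (Fin n) (Fin n) R :=
  of fun l k => (∏ m ∈ {k}ᶜ, (X - C (y m))).coeff l

theorem vandermonde_mul_nodalCoeff {R : Type*} [CommRing R] {n : ℕ} (x y : Fin n → R) :
    vandermonde x * nodalCoeff y = of fun j k => ∏ m ∈ {k}ᶜ, (x j - y m) := by
  nontriviality R
  ext j k
  have hdeg : (∏ m ∈ ({k}ᶜ : Finset (Fin n)), (X - C (y m))).natDegree < n := by
    rw [natDegree_finsetProd_X_sub_C_eq_card, card_compl, card_singleton, Fintype.card_fin]
    have := k.pos
    omega
  have h := eval_eq_sum_range' hdeg (x j)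
  rw [Finset.sum_range] at h
  simp only [eval_prod, eval_sub, eval_X, eval_C] at h
  simp only [mul_apply, vandermonde_apply, nodalCoeff, of_apply, h]
  exact Finset.sum_congr rfl fun _ _ => mul_comm _ _

theorem vandermonde_mul_nodalCoeff_self {R : Type*} [CommRing R] {n : ℕ} (y : Fin n → R) :
    vandermonde y * nodalCoeff y = diagonal fun k => ∏ m ∈ {k}ᶜ, (y k - y m) := by
  rw [vandermonde_mul_nodalCoeff]
  ext j k
  obtain rfl | h := eq_or_ne j k
  · simp
  · rw [diagonal_apply_ne _ h, of_apply]
    exact Finset.prod_eq_zero (i := j) (by simpa using h) (sub_self _)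

/-- The `2n × 2n` matrix built from two Vandermonde matrices with weighted rows. -/
def weightedVandermonde {R : Type*} [CommRing R] {n : ℕ} (x y a b c d : Fin n → R) :
    Matrix (Fin n ⊕ Fin n) (Fin n ⊕ Fin n) R :=
  fromBlocks (diagonal a * vandermonde x) (diagonal b * vandermonde x)
    (diagonal c * vandermonde y) (diagonal d * vandermonde y)

/-- The matrix `(a j * d k - b j * c k) / (x j - y k)` with row `j` multiplied by
`∏ m, (x j - y m)`. -/
def clearedCauchy {R : Type*} [CommRing R] {n : ℕ} (x y a b c d : Fin n → R) :
    Matrix (Fin n) (Fin n) R :=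
  of fun j k => (a j * d k - b j * c k) * ∏ m ∈ {k}ᶜ, (x j - y m)

theorem det_weightedVandermonde_mul {R : Type*} [CommRing R] {n : ℕ} (x y a b c d : Fin n → R) :
    (weightedVandermonde x y a b c d).det * (nodalCoeff y).det ^ 2 * ∏ k, d k =
      (clearedCauchy x y a b c d).det * ((∏ k, d k) * ∏ k, ∏ m ∈ {k}ᶜ, (y k - y m)) := by
  have hmul : weightedVandermonde x y a b c d * fromBlocks (nodalCoeff y) 0 0 (nodalCoeff y) *
      fromBlocks (diagonal d) 0 (-diagonal c) 1 =
      fromBlocks (clearedCauchy x y a b c d)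
        (diagonal b * of fun j k => ∏ m ∈ {k}ᶜ, (x j - y m)) 0
        (diagonal fun k => d k * ∏ m ∈ {k}ᶜ, (y k - y m)) := by
    simp only [weightedVandermonde, fromBlocks_multiply, Matrix.mul_assoc, Matrix.mul_zero,
      add_zero, zero_add, Matrix.mul_one, vandermonde_mul_nodalCoeff_self]
    simp only [← Matrix.mul_assoc (vandermonde x), vandermonde_mul_nodalCoeff]
    congr 1
    · ext j k
      simp only [clearedCauchy, Matrix.mul_neg, ← Matrix.mul_assoc, Matrix.add_apply,
        Matrix.neg_apply,
        diagonal_mul, mul_diagonal, of_apply]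
      ring
    · simp only [diagonal_mul_diagonal, diagonal_neg, diagonal_add]
      rw [← diagonal_zero]
      congr 1
      ext k
      ring
    · simp only [diagonal_mul_diagonal]
  have h := congrArg det hmul
  simpa only [det_mul, det_fromBlocks_zero₂₁, det_fromBlocks_zero₁₂, det_diagonal, det_one,
    mul_one, Finset.prod_mul_distrib, ← sq] using h

theorem det_clearedCauchy_of_injective {R : Type*} [CommRing R] [IsDomain R] {n : ℕ}
    (x y a b c d : Fin n → R) (hy : Function.Injective y) (hd : ∀ k, d k ≠ 0) :
    (clearedCauchy x y a b c d).det =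
      (-1) ^ (n * (n - 1) / 2) * (weightedVandermonde x y a b c d).det := by
  have hd' : ∏ k, d k ≠ 0 := Finset.prod_ne_zero_iff.2 fun k _ => hd k
  have hp : ∏ k, ∏ m ∈ {k}ᶜ, (y k - y m) ≠ 0 := by
    refine Finset.prod_ne_zero_iff.2 fun k _ => Finset.prod_ne_zero_iff.2 fun m hm => ?_
    exact sub_ne_zero.2 (hy.ne (by simpa [eq_comm] using hm))
  have hW := congrArg det (vandermonde_mul_nodalCoeff_self y)
  rw [det_mul, det_diagonal] at hW
  have hsq := prod_prod_compl_sub_eq_sign_mul_det_vandermonde_sq y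
  have hT := det_weightedVandermonde_mul x y a b c d
  generalize ∏ k, ∏ m ∈ {k}ᶜ, (y k - y m) = p at *
  generalize (-1 : R) ^ (n * (n - 1) / 2) = s at *
  generalize (vandermonde y).det = w at *
  generalize (nodalCoeff y).det = M at *
  refine mul_right_cancel₀ (mul_ne_zero hd' (pow_ne_zero 2 hp)) ?_
  linear_combination (clearedCauchy x y a b c d).det * (∏ k, d k) * p * hsq
    - s * w ^ 2 * hT
    + s * (weightedVandermonde x y a b c d).det * (∏ k, d k) * (w * M + p) * hW

theorem map_clearedCauchy {R R' : Type*} [CommRing R] [CommRing R'] (f : R →+* R') {n : ℕ}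
    (x y a b c d : Fin n → R) :
    (clearedCauchy x y a b c d).map f =
      clearedCauchy (f ∘ x) (f ∘ y) (f ∘ a) (f ∘ b) (f ∘ c) (f ∘ d) := by
  ext j k
  simp [clearedCauchy]

theorem map_weightedVandermonde {R R' : Type*} [CommRing R] [CommRing R'] (f : R →+* R') {n : ℕ}
    (x y a b c d : Fin n → R) :
    (weightedVandermonde x y a b c d).map f =
      weightedVandermonde (f ∘ x) (f ∘ y) (f ∘ a) (f ∘ b) (f ∘ c) (f ∘ d) := by
  ext (j | j) (k | k) <;> simp [weightedVandermonde, vandermonde_apply]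

theorem det_clearedCauchy {R : Type*} [CommRing R] [IsDomain R] {n : ℕ}
    (x y a b c d : Fin n → R) :
    (clearedCauchy x y a b c d).det =
      (-1) ^ (n * (n - 1) / 2) * (weightedVandermonde x y a b c d).det := by
  let y' : Fin n → R[X] := fun k => C (y k) + X ^ ((k : ℕ) + 1)
  let d' : Fin n → R[X] := fun k => C (d k) + X
  have hy : Function.Injective y' := fun j k h => by
    have h' := congrArg (coeff · ((j : ℕ) + 1)) h
    by_contra hjk
    have hjk' : (j : ℕ) ≠ k := fun h => hjk (Fin.ext h)
    simp [y', coeff_X_pow, hjk'] at h'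
  have hd : ∀ k, d' k ≠ 0 := fun k h => by
    simpa [d', coeff_C] using congrArg (coeff · 1) h
  have h := congrArg (evalRingHom (0 : R))
    (det_clearedCauchy_of_injective (C ∘ x) y' (C ∘ a) (C ∘ b) (C ∘ c) d' hy hd)
  rw [map_mul, map_pow, map_neg, map_one, RingHom.map_det, RingHom.map_det,
    RingHom.mapMatrix_apply, RingHom.mapMatrix_apply, map_clearedCauchy,
    map_weightedVandermonde] at h
  simpa [Function.comp_def, y', d'] using h


/-- the determinantal identity (Lemma 3.1 of the paper). -/
theorem stmt_0 (S : ℕ) (hS : 1 ≤ S) (x y a b c d : Fin S → ℂ)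
    (hxy : ∀ j k, x j ≠ y k) :
    Matrix.det (Matrix.of fun j k : Fin S => (a j * d k - b j * c k) / (x j - y k))
      = (-1 : ℂ) ^ (S * (S - 1) / 2) * (∏ j, ∏ k, (x j - y k))⁻¹ *
        Matrix.det (Matrix.of fun p q : Fin S ⊕ Fin S =>
          match p, q with
          | Sum.inl j, Sum.inl ℓ => x j ^ (ℓ : ℕ) * a j
          | Sum.inl j, Sum.inr ℓ => x j ^ (ℓ : ℕ) * b j
          | Sum.inr j, Sum.inl ℓ => y j ^ (ℓ : ℕ) * c j
          | Sum.inr j, Sum.inr ℓ => y j ^ (ℓ : ℕ) * d j) := by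
  have hT : (Matrix.of fun p q : Fin S ⊕ Fin S =>
          match p, q with
          | Sum.inl j, Sum.inl ℓ => x j ^ (ℓ : ℕ) * a j
          | Sum.inl j, Sum.inr ℓ => x j ^ (ℓ : ℕ) * b j
          | Sum.inr j, Sum.inl ℓ => y j ^ (ℓ : ℕ) * c j
          | Sum.inr j, Sum.inr ℓ => y j ^ (ℓ : ℕ) * d j) = weightedVandermonde x y a b c d := by
    ext (j | j) (k | k) <;> simp [weightedVandermonde, vandermonde_apply, mul_comm]
  have hP : ∏ j, ∏ k, (x j - y k) ≠ 0 := Finset.prod_ne_zero_iff.2 fun j _ =>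
    Finset.prod_ne_zero_iff.2 fun k _ => sub_ne_zero.2 (hxy j k)
  have hC : clearedCauchy x y a b c d = of fun j k =>
      (∏ m, (x j - y m)) * of (fun j k => (a j * d k - b j * c k) / (x j - y k)) j k := by
    ext j k
    have := sub_ne_zero.2 (hxy j k)
    simp only [clearedCauchy, of_apply, Fintype.prod_eq_mul_prod_compl k (fun m => x j - y m)]
    field_simp
  have h := det_clearedCauchy x y a b c d
  rw [hC, det_mul_column] at h
  rw [hT, mul_right_comm, ← h]
  field_simp
end

section
/- Let S ≥ 1, let γ_1,…,γ_S, β_1,…,β_S be complex numbers with γ_ℓ ≠ β_j for all ℓ, j, and let A_1,…,A_S and B_1,…,B_S be 2 × 2 complex matrices with det A_ℓ = 1 for every ℓ. Then det[ (A_ℓ^{−1} B_j)_{21} / (γ_ℓ − β_j) ]_{ℓ,j=1}^S = (−1)^{S(S−1)/2} · (∏_{ℓ,j=1}^S (γ_ℓ − β_j))^{−1} · det T, where T is the 2S × 2S matrix whose row ℓ (for 1 ≤ ℓ ≤ S) is (γ_ℓ^{m−1} (A_ℓ)_{11})_{m=1}^S followed by (γ_ℓ^{m−1} (A_ℓ)_{21})_{m=1}^S,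 and whose row S + j (for 1 ≤ j ≤ S) is (β_j^{m−1} (B_j)_{11})_{m=1}^S followed by (β_j^{m−1} (B_j)_{21})_{m=1}^S. -/
open Matrix Finset in
theorem det_vandermonde_sq {R : Type*} [CommRing R] {n : ℕ} (v : Fin n → R) :
    (vandermonde v).det ^ 2 =
      (-1) ^ (n * (n - 1) / 2) * ∏ i, ∏ j ∈ univ.erase i, (v i - v j) := by
  have hoff : ∏ i, ∏ j ∈ univ.erase i, (v i - v j) =
      ∏ i, ∏ j ∈ Ioi i, (v j - v i) * (v i - v j) := by
    rw [prod_prod_Ioi_mul_eq_prod_prod_off_diag (fun i j => v i - v j), prod_comm' (t' := univ)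
      (s' := fun i => univ.erase i)]
    · refine prod_congr rfl fun i _ => prod_congr ?_ fun _ _ => rfl
      ext j; simp
    · simp [eq_comm]
  have hcard : ∏ i : Fin n, ∏ _j ∈ Ioi i, (-1 : R) = (-1) ^ (n * (n - 1) / 2) := by
    simp only [prod_const, prod_pow_eq_pow_sum, Fin.card_Ioi]
    rw [Fin.sum_univ_eq_sum_range (fun i => n - 1 - i), sum_range_reflect (fun i => i),
      sum_range_id]
  rw [hoff, ← hcard, det_vandermonde]
  simp only [← prod_mul_distrib, ← prod_pow]
  exact prod_congr rfl fun i _ => prod_congr rfl fun j _ => by ring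

open Matrix Finset Polynomial in
theorem vandermonde_eq_lagrange_mul {F : Type*} [Field F] {n : ℕ} {v : Fin n → F}
    (hv : Function.Injective v) (w : Fin n → F) :
    vandermonde w =
      (Matrix.of fun j i => (Lagrange.basis univ v i).eval (w j)) * vandermonde v := by
  ext j m
  have h := Lagrange.eq_interpolate (s := univ) (v := v) (f := (X : F[X]) ^ (m : ℕ)) hv.injOn
    (by rw [degree_X_pow]; simp)
  have h' := congrArg (eval (w j)) h
  rw [Lagrange.interpolate_apply, eval_finsetSum] at h'
  simpa [Matrix.mul_apply, vandermonde_apply, mul_comm] using h'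

open Matrix in
/-- The determinant of a block matrix with two blocks of rows, each made of a Vandermonde matrix
with rows scaled in two ways. -/
theorem det_fromBlocks_vandermonde_of_ne {F : Type*} [Field F] {n : ℕ} {γ β : Fin n → F}
    (hγ : Function.Injective γ) (hd : ∀ i j, γ i ≠ β j) {a : Fin n → F} (ha : ∀ i, a i ≠ 0)
    (c b d : Fin n → F) :
    (fromBlocks (diagonal a * vandermonde γ) (diagonal c * vandermonde γ)
      (diagonal b * vandermonde β) (diagonal d * vandermonde β)).det =
    (-1) ^ (n * (n - 1) / 2) *
      (Matrix.of fun i j => (∏ k, (γ i - β k)) *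
        ((a i * d j - c i * b j) / (γ i - β j))).det := by
  set K : Matrix (Fin n) (Fin n) F :=
    Matrix.of fun j i => (Lagrange.basis Finset.univ γ i).eval (β j) with hK
  set N : Matrix (Fin n) (Fin n) F :=
    Matrix.of fun i j => (a i * d j - c i * b j) / (γ i - β j) with hN
  have hfac : fromBlocks (diagonal a * vandermonde γ) (diagonal c * vandermonde γ)
      (diagonal b * vandermonde β) (diagonal d * vandermonde β) =
      fromBlocks (diagonal a) (diagonal c) (diagonal b * K) (diagonal d * K) *
        fromBlocks (vandermonde γ) 0 0 (vandermonde γ) := by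
    rw [fromBlocks_multiply, vandermonde_eq_lagrange_mul hγ β]
    simp [Matrix.mul_assoc, hK]
  have hblock : (fromBlocks (diagonal a) (diagonal c) (diagonal b * K) (diagonal d * K)).det =
      (Matrix.of fun j i => (a i * d j - c i * b j) * K j i).det := by
    let : Invertible a := ⟨a⁻¹, by ext i; simp [ha], by ext i; simp [ha]⟩
    let : Invertible (diagonal a) := diagonalInvertible a
    rw [det_fromBlocks₁₁, det_diagonal, ← det_mul_row]
    congr 1
    ext j i
    have hinv : ⅟ (diagonal a) = diagonal a⁻¹ := rfl
    have := ha i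
    simp only [hinv, Matrix.mul_assoc, diagonal_mul_diagonal, of_apply, Matrix.sub_apply,
      diagonal_mul, mul_diagonal, Pi.inv_apply]
    field_simp
  have hentry : (Matrix.of fun j i => (a i * d j - c i * b j) * K j i) =
      Matrix.of fun j i => (∏ k, (γ k - β j)) *
        (Matrix.of fun j i => ((-1) ^ (n + 1) * Lagrange.nodalWeight Finset.univ γ i) *
          Nᵀ j i) j i := by
    ext j i
    have h := sub_ne_zero.2 (hd i j)
    have h' := sub_ne_zero.2 (hd i j).symm
    have hp : ∏ k, (β j - γ k) = (-1) ^ n * ∏ k, (γ k - β j) := by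
      simpa using Finset.prod_neg (s := Finset.univ) (fun k => γ k - β j)
    simp only [of_apply, transpose_apply, hK, hN,
      Lagrange.eval_basis_not_at_node (Finset.mem_univ i) (hd i j).symm, Lagrange.eval_nodal, hp]
    rw [← neg_sub (γ i), inv_neg]
    field_simp
    ring
  have hsign : (∏ _i : Fin n, (-1 : F) ^ (n + 1)) = 1 := by
    rw [Finset.prod_const, Finset.card_univ, Fintype.card_fin, ← pow_mul, mul_comm]
    exact (Nat.even_mul_succ_self n).neg_one_pow
  have hw : (∏ i, ∏ j ∈ Finset.univ.erase i, (γ i - γ j)) *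
      ∏ i, Lagrange.nodalWeight Finset.univ γ i = 1 := by
    simp only [Lagrange.nodalWeight, ← Finset.prod_mul_distrib]
    refine Finset.prod_eq_one fun i _ => Finset.prod_eq_one fun j hj => mul_inv_cancel₀ ?_
    exact sub_ne_zero.2 (hγ.ne (Finset.ne_of_mem_erase hj).symm)
  have hN' : (Matrix.of fun i j => (∏ k, (γ i - β k)) *
        ((a i * d j - c i * b j) / (γ i - β j))).det = (∏ i, ∏ k, (γ i - β k)) * N.det :=
    det_mul_column (fun i => ∏ k, (γ i - β k)) N
  rw [hfac, det_mul, hblock, det_fromBlocks_zero₂₁, ← sq, det_vandermonde_sq, hentry,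
    det_mul_column, det_mul_row, det_transpose, Finset.prod_mul_distrib, hsign, hN',
    Finset.prod_comm]
  linear_combination (-1) ^ (n * (n - 1) / 2) * (∏ i, ∏ k, (γ i - β k)) * N.det * hw

open Filter Topology in
theorem eventually_add_mul_ne_zero {u v : ℂ} (h : u ≠ 0 ∨ v ≠ 0) :
    ∀ᶠ t in 𝓝[≠] (0 : ℂ), u + t * v ≠ 0 := by
  by_cases hu : u = 0
  · filter_upwards [self_mem_nhdsWithin] with t ht
    simpa [hu] using ⟨ht, h.resolve_left (not_not.2 hu)⟩
  · have hc : Continuous fun t : ℂ => u + t * v := by fun_prop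
    exact nhdsWithin_le_nhds (hc.continuousAt.eventually_ne (by simpa using hu))

open Matrix Filter Topology in
theorem det_fromBlocks_vandermonde {n : ℕ} (γ β a c b d : Fin n → ℂ) (hd : ∀ i j, γ i ≠ β j) :
    (fromBlocks (diagonal a * vandermonde γ) (diagonal c * vandermonde γ)
      (diagonal b * vandermonde β) (diagonal d * vandermonde β)).det =
    (-1) ^ (n * (n - 1) / 2) *
      (Matrix.of fun i j => (a i * d j - c i * b j) *
        ∏ k ∈ Finset.univ.erase j, (γ i - β k)).det := by
  let γ' : ℂ → Fin n → ℂ := fun t i => γ i + t * (i : ℕ)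
  let a' : ℂ → Fin n → ℂ := fun t i => a i + t * 1
  have hγ' : Continuous γ' := by fun_prop
  have ha' : Continuous a' := by fun_prop
  let f : ℂ → ℂ := fun t =>
    (fromBlocks (diagonal (a' t) * vandermonde (γ' t)) (diagonal c * vandermonde (γ' t))
      (diagonal b * vandermonde β) (diagonal d * vandermonde β)).det
  let g : ℂ → ℂ := fun t => (-1) ^ (n * (n - 1) / 2) *
      (Matrix.of fun i j => (a' t i * d j - c i * b j) *
        ∏ k ∈ Finset.univ.erase j, (γ' t i - β k)).det
  have hV : Continuous fun t => vandermonde (γ' t) :=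
    continuous_matrix fun i j => by simp only [vandermonde_apply]; fun_prop
  have hf : Continuous f :=
    (Continuous.matrix_fromBlocks (ha'.matrix_diagonal.matrix_mul hV)
      (continuous_const.matrix_mul hV) continuous_const continuous_const).matrix_det
  have hg : Continuous g :=
    continuous_const.mul (continuous_matrix fun i j => by
      simp only [of_apply]; fun_prop).matrix_det
  have hfg : ∀ᶠ t in 𝓝[≠] (0 : ℂ), f t = g t := by
    have h1 : ∀ᶠ t in 𝓝[≠] (0 : ℂ), ∀ i j, i ≠ j → (γ i - γ j) + t * ((i : ℕ) - (j : ℕ)) ≠ 0 := by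
      refine eventually_all.2 fun i => eventually_all.2 fun j => ?_
      by_cases hij : i = j
      · simp [hij]
      · filter_upwards [eventually_add_mul_ne_zero (u := γ i - γ j)
          (v := ((i : ℕ) : ℂ) - (j : ℕ)) (Or.inr (by
            rw [sub_ne_zero]; exact_mod_cast fun h => hij (Fin.ext h)))] with t ht _
        exact ht
    have h2 : ∀ᶠ t in 𝓝[≠] (0 : ℂ), ∀ i j, (γ i - β j) + t * (i : ℕ) ≠ 0 :=
      eventually_all.2 fun i => eventually_all.2 fun j =>
        eventually_add_mul_ne_zero (Or.inl (sub_ne_zero.2 (hd i j)))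
    have h3 : ∀ᶠ t in 𝓝[≠] (0 : ℂ), ∀ i, a' t i ≠ 0 :=
      eventually_all.2 fun i => eventually_add_mul_ne_zero (Or.inr one_ne_zero)
    filter_upwards [h1, h2, h3] with t h1 h2 h3
    have hne : ∀ i j, γ' t i ≠ β j := fun i j h =>
      h2 i j (by simp only [γ'] at h; linear_combination h)
    have hinj : Function.Injective (γ' t) := fun i j h => by
      by_contra hij
      exact h1 i j hij (by simp only [γ'] at h; linear_combination h)
    simp only [f, g]
    rw [det_fromBlocks_vandermonde_of_ne hinj hne h3]
    congr 2
    ext i j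
    have := sub_ne_zero.2 (hne i j)
    simp only [of_apply, ← Finset.mul_prod_erase _ _ (Finset.mem_univ j)]
    field_simp
  have h0 : f 0 = g 0 := tendsto_nhds_unique
    ((hf.tendsto 0).mono_left nhdsWithin_le_nhds)
    (((hg.tendsto 0).mono_left nhdsWithin_le_nhds).congr' (hfg.mono fun _ h => h.symm))
  simpa [f, g, γ', a'] using h0


/-- specialization of the determinantal lemma to (2,1) entries of
products `Aₗ⁻¹ * Bⱼ` of 2×2 matrices of determinant one (equation (3.2) of the paper). -/
theorem stmt_1 (S : ℕ) (hS : 1 ≤ S) (γ β : Fin S → ℂ)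
    (hd : ∀ ℓ j, γ ℓ ≠ β j)
    (A B : Fin S → Matrix (Fin 2) (Fin 2) ℂ)
    (hA : ∀ ℓ, (A ℓ).det = 1) :
    Matrix.det (Matrix.of fun ℓ j : Fin S => ((A ℓ)⁻¹ * B j) 1 0 / (γ ℓ - β j))
      = (-1 : ℂ) ^ (S * (S - 1) / 2) * (∏ ℓ, ∏ j, (γ ℓ - β j))⁻¹ *
        Matrix.det (Matrix.of fun p q : Fin S ⊕ Fin S =>
          match p, q with
          | Sum.inl ℓ, Sum.inl m => γ ℓ ^ (m : ℕ) * A ℓ 0 0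
          | Sum.inl ℓ, Sum.inr m => γ ℓ ^ (m : ℕ) * A ℓ 1 0
          | Sum.inr j, Sum.inl m => β j ^ (m : ℕ) * B j 0 0
          | Sum.inr j, Sum.inr m => β j ^ (m : ℕ) * B j 1 0) := by
  have hT : (Matrix.of fun p q : Fin S ⊕ Fin S =>
          match p, q with
          | Sum.inl ℓ, Sum.inl m => γ ℓ ^ (m : ℕ) * A ℓ 0 0
          | Sum.inl ℓ, Sum.inr m => γ ℓ ^ (m : ℕ) * A ℓ 1 0
          | Sum.inr j, Sum.inl m => β j ^ (m : ℕ) * B j 0 0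
          | Sum.inr j, Sum.inr m => β j ^ (m : ℕ) * B j 1 0) =
      Matrix.fromBlocks
        (Matrix.diagonal (fun i => A i 0 0) * Matrix.vandermonde γ)
        (Matrix.diagonal (fun i => A i 1 0) * Matrix.vandermonde γ)
        (Matrix.diagonal (fun i => B i 0 0) * Matrix.vandermonde β)
        (Matrix.diagonal (fun i => B i 1 0) * Matrix.vandermonde β) := by
    ext (p | p) (q | q) <;> simp [Matrix.vandermonde_apply, mul_comm]
  have hN : (Matrix.of fun i j => (A i 0 0 * B j 1 0 - A i 1 0 * B j 0 0) *
        ∏ k ∈ Finset.univ.erase j, (γ i - β k)) =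
      Matrix.of fun i j => (∏ k, (γ i - β k)) *
        (Matrix.of fun ℓ j : Fin S => ((A ℓ)⁻¹ * B j) 1 0 / (γ ℓ - β j)) i j := by
    ext i j
    have h := sub_ne_zero.2 (hd i j)
    have hAB : ((A i)⁻¹ * B j) 1 0 = A i 0 0 * B j 1 0 - A i 1 0 * B j 0 0 := by
      rw [Matrix.inv_def, hA, Matrix.adjugate_fin_two]
      simp [Matrix.mul_apply, Fin.sum_univ_two]
      ring
    simp only [Matrix.of_apply, hAB, ← Finset.mul_prod_erase _ _ (Finset.mem_univ j)]
    field_simp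
  have hP : (∏ ℓ, ∏ j, (γ ℓ - β j)) ≠ 0 :=
    Finset.prod_ne_zero_iff.2 fun i _ => Finset.prod_ne_zero_iff.2 fun j _ =>
      sub_ne_zero.2 (hd i j)
  have hs : (-1 : ℂ) ^ (S * (S - 1) / 2) * (-1 : ℂ) ^ (S * (S - 1) / 2) = 1 := by
    rw [← mul_pow]; simp
  rw [hT, det_fromBlocks_vandermonde _ _ _ _ _ _ hd, hN, Matrix.det_mul_column]
  generalize (-1 : ℂ) ^ (S * (S - 1) / 2) = s at hs ⊢
  field_simp
  linear_combination (-Matrix.det (Matrix.of fun ℓ j : Fin S =>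
    ((A ℓ)⁻¹ * B j) 1 0 / (γ ℓ - β j))) * hs
end

section
/- Let f : ℂ → ℂ be an entire function satisfying the Airy differential equation f″(z) = z·f(z) for all z ∈ ℂ, let S ≥ 1, and let x_1,…,x_{2S} be complex numbers. Then det[ f^{(ℓ−1)}(x_j) ]_{ℓ,j=1}^{2S} = (−1)^{S(S−1)/2} · det M, where f^{(m)} denotes the m-th complex derivative of f and M is the 2S × 2S matrix whose row j is (f(x_j), x_j f(x_j), …, x_j^{S−1} f(x_j), f′(x_j), x_j f′(x_j), …, x_j^{S−1} f′(x_j)). -/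
/-- The interleaved family `f, f', z f, z f', z² f, z² f', …`. -/
noncomputable def interleaved (f : ℂ → ℂ) (n : ℕ) (z : ℂ) : ℂ :=
  z ^ (n / 2) * if n % 2 = 0 then f z else deriv f z

/-- Coefficients of the derivatives of a solution of the Airy equation in the interleaved family. -/
def airyCoeff : ℕ → ℕ → ℂ
  | 0, n => if n = 0 then 1 else 0
  | m + 1, 0 => airyCoeff m 2
  | m + 1, n + 1 => airyCoeff m n + ((n + 3) / 2 : ℕ) * airyCoeff m (n + 3)

theorem airyCoeff_of_lt {m n : ℕ} (h : m < n) : airyCoeff m n = 0 := by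
  induction m generalizing n with
  | zero => simp [airyCoeff, h.ne']
  | succ m ih =>
    obtain _ | n := n
    · omega
    · simp [airyCoeff, ih (show m < n by omega), ih (show m < n + 3 by omega)]

theorem airyCoeff_self (m : ℕ) : airyCoeff m m = 1 := by
  induction m with
  | zero => simp [airyCoeff]
  | succ m ih => simp [airyCoeff, ih, airyCoeff_of_lt (show m < m + 3 by omega)]

theorem hasDerivAt_interleaved {f : ℂ → ℂ} (hf : Differentiable ℂ f)
    (hairy : ∀ z : ℂ, iteratedDeriv 2 f z = z * f z) (n : ℕ) (z : ℂ) :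
    HasDerivAt (interleaved f n)
      (interleaved f (n + 1) z + (n / 2 : ℕ) * interleaved f (n - 2) z) z := by
  have h₁ : HasDerivAt f (deriv f z) z := (hf z).hasDerivAt
  have h₂ : HasDerivAt (deriv f) (z * f z) z := by
    rw [← hairy z, iteratedDeriv_succ, iteratedDeriv_one]
    exact (hf.deriv z).hasDerivAt
  obtain ⟨k, rfl | rfl⟩ := Nat.even_or_odd' n
  · have e : (2 * k - 2) / 2 = k - 1 := by omega
    have e' : (2 * k - 2) % 2 = 0 := by omega
    have e'' : (2 * k + 1) / 2 = k := by omega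
    have hfun : interleaved f (2 * k) = fun w => w ^ k * f w := by
      ext w
      simp [interleaved]
    rw [hfun]
    refine ((hasDerivAt_pow k z).fun_mul h₁).congr_deriv ?_
    simp [interleaved, e, e', e'']
    ring
  · obtain _ | k := k
    · have hfun : interleaved f (2 * 0 + 1) = deriv f := by
        ext w
        simp [interleaved]
      rw [hfun]
      exact h₂.congr_deriv (by simp [interleaved])
    have e : (2 * (k + 1) + 1 - 2) / 2 = k := by omega
    have e' : (2 * (k + 1) + 1 - 2) % 2 = 1 := by omega
    have e'' : (2 * (k + 1) + 1) / 2 = k + 1 := by omega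
    have e₃ : (2 * (k + 1) + 1 + 1) / 2 = k + 2 := by omega
    have e₄ : (2 * (k + 1) + 1 + 1) % 2 = 0 := by omega
    have e₅ : (2 * (k + 1) + 1) % 2 = 1 := by omega
    have hfun : interleaved f (2 * (k + 1) + 1) = fun w => w ^ (k + 1) * deriv f w := by
      ext w
      simp [interleaved, e'', e₅]
    rw [hfun]
    refine ((hasDerivAt_pow (k + 1) z).fun_mul h₂).congr_deriv ?_
    simp only [interleaved, e, e', e'', e₃, e₄]
    simp
    ring

theorem sum_airyCoeff_succ (g : ℕ → ℂ) {m N : ℕ} (h : m + 1 < N) :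
    ∑ n ∈ Finset.range N, airyCoeff (m + 1) n * g n =
      ∑ n ∈ Finset.range N, airyCoeff m n * (g (n + 1) + (n / 2 : ℕ) * g (n - 2)) := by
  obtain ⟨N, rfl⟩ : ∃ k, N = k + 2 := ⟨N - 2, by omega⟩
  have hN : airyCoeff m (N + 1) = 0 := airyCoeff_of_lt (by omega)
  have hN₂ : airyCoeff m (N + 2) = 0 := airyCoeff_of_lt (by omega)
  have hN₃ : airyCoeff m (N + 3) = 0 := airyCoeff_of_lt (by omega)
  have key : ∑ n ∈ Finset.range (N + 1), ((n + 3) / 2 : ℕ) * airyCoeff m (n + 3) * g (n + 1) +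
      airyCoeff m 2 * g 0 =
      ∑ n ∈ Finset.range (N + 2), airyCoeff m n * ((n / 2 : ℕ) * g (n - 2)) := by
    have h₁ : ∑ n ∈ Finset.range (N + 4), airyCoeff m n * ((n / 2 : ℕ) * g (n - 2)) =
        ∑ n ∈ Finset.range (N + 2), airyCoeff m n * ((n / 2 : ℕ) * g (n - 2)) := by
      rw [Finset.sum_range_succ, Finset.sum_range_succ, hN₂, hN₃]
      simp
    rw [← h₁, Finset.sum_range_succ' _ (N + 3), Finset.sum_range_succ' _ (N + 2),
      Finset.sum_range_succ' _ (N + 1)]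
    simp
    exact Finset.sum_congr rfl fun n _ => by ring
  simp only [mul_add, Finset.sum_add_distrib]
  rw [← key, Finset.sum_range_succ', Finset.sum_range_succ _ (N + 1), hN]
  simp only [airyCoeff, add_mul, Finset.sum_add_distrib]
  ring

theorem iteratedDeriv_eq_sum_airyCoeff {f : ℂ → ℂ} (hf : Differentiable ℂ f)
    (hairy : ∀ z : ℂ, iteratedDeriv 2 f z = z * f z) {m N : ℕ} (h : m < N) (z : ℂ) :
    iteratedDeriv m f z = ∑ n ∈ Finset.range N, airyCoeff m n * interleaved f n z := by
  induction m generalizing z with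
  | zero =>
    rw [Finset.sum_eq_single_of_mem 0 (Finset.mem_range.mpr h)]
    · simp [airyCoeff, interleaved]
    · intro n _ hn
      simp [airyCoeff, hn]
  | succ m ih =>
    rw [iteratedDeriv_succ, funext (ih (by omega)), sum_airyCoeff_succ _ h]
    exact (HasDerivAt.fun_sum fun n _ =>
      (hasDerivAt_interleaved hf hairy n z).const_mul (airyCoeff m n)).deriv

/-- The inverse riffle: even indices go to the first half, odd indices to the second half. -/
def unriffle (S : ℕ) : Equiv.Perm (Fin (2 * S)) where
  toFun n := ⟨if (n : ℕ) % 2 = 0 then n / 2 else S + n / 2, by split_ifs <;> omega⟩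
  invFun c := ⟨if (c : ℕ) < S then 2 * c else 2 * (c - S) + 1, by split_ifs <;> omega⟩
  left_inv n := by
    ext
    dsimp only
    split_ifs <;> omega
  right_inv c := by
    ext
    dsimp only
    split_ifs <;> omega

theorem prod_range_two_mul_riffle {S t k : ℕ} (hk : k ≤ t) (ht : t < S) :
    ∏ i ∈ Finset.range (2 * k),
      (if (if i % 2 = 0 then i / 2 else S + i / 2) < t then (1 : ℤˣ) else -1) = (-1) ^ k := by
  induction k with
  | zero => simp
  | succ k ih =>
    have e : (2 * k + 1) % 2 = 1 := by omega
    rw [show 2 * (k + 1) = 2 * k + 1 + 1 by ring, Finset.prod_range_succ, Finset.prod_range_succ,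
      ih (by omega), e, pow_succ]
    simp [show k < t by omega, show ¬ S + (2 * k + 1) / 2 < t by omega]

theorem sign_unriffle (S : ℕ) : Equiv.Perm.sign (unriffle S) = (-1) ^ (S * (S - 1) / 2) := by
  have inner (j : Fin (2 * S)) :
      ∏ i ∈ Finset.Iio j, (if unriffle S i < unriffle S j then (1 : ℤˣ) else -1) =
        if (j : ℕ) % 2 = 0 then (-1) ^ ((j : ℕ) / 2) else 1 := by
    split_ifs with hj
    · rw [← prod_range_two_mul_riffle le_rfl (show (j : ℕ) / 2 < S by omega),
        show 2 * ((j : ℕ) / 2) = j by omega, ← Nat.Iio_eq_range, ← Fin.map_valEmbedding_Iio,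
        Finset.prod_map]
      simp [unriffle, hj]
    · refine Finset.prod_eq_one fun i hi => if_pos ?_
      have : (i : ℕ) < j := Fin.lt_def.mp (Finset.mem_Iio.mp hi)
      simp only [unriffle, Equiv.coe_fn_mk, Fin.mk_lt_mk]
      split_ifs <;> omega
  have outer (T : ℕ) : ∏ j ∈ Finset.range (2 * T),
      (if j % 2 = 0 then (-1 : ℤˣ) ^ (j / 2) else 1) = (-1) ^ (∑ k ∈ Finset.range T, k) := by
    induction T with
    | zero => simp
    | succ T ih =>
      rw [show 2 * (T + 1) = 2 * T + 1 + 1 by ring, Finset.prod_range_succ,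
        Finset.prod_range_succ, ih, Finset.sum_range_succ, pow_add]
      simp [show (2 * T + 1) % 2 = 1 by omega]
  rw [Equiv.Perm.sign_eq_prod_prod_Iio, Finset.prod_congr rfl fun j _ => inner j,
    Fin.prod_univ_eq_prod_range (fun j => if j % 2 = 0 then (-1 : ℤˣ) ^ (j / 2) else 1), outer,
    Finset.sum_range_id]

/-- reduction of the matrix of iterated derivatives of a solution of
the Airy equation `f'' = z f` to the interleaved matrix of monomial multiples of
`f` and `f'` (proof of Theorem 1.1 of the paper). -/
theorem stmt_3 (f : ℂ → ℂ) (hf : Differentiable ℂ f)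
    (hairy : ∀ z : ℂ, iteratedDeriv 2 f z = z * f z)
    (S : ℕ) (hS : 1 ≤ S) (x : Fin (2 * S) → ℂ) :
    Matrix.det (Matrix.of fun ℓ j : Fin (2 * S) => iteratedDeriv (ℓ : ℕ) f (x j))
      = (-1 : ℂ) ^ (S * (S - 1) / 2) *
        Matrix.det (Matrix.of fun j c : Fin (2 * S) =>
          if (c : ℕ) < S then x j ^ (c : ℕ) * f (x j)
          else x j ^ ((c : ℕ) - S) * deriv f (x j)) := by

  set M := Matrix.of fun j c : Fin (2 * S) =>
    if (c : ℕ) < S then x j ^ (c : ℕ) * f (x j) else x j ^ ((c : ℕ) - S) * deriv f (x j) with hM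
  let L : Matrix (Fin (2 * S)) (Fin (2 * S)) ℂ := Matrix.of fun ℓ n => airyCoeff ℓ n
  have hL : L.det = 1 := by
    rw [Matrix.det_of_isLowerTriangular L fun i j hij => airyCoeff_of_lt hij]
    exact Finset.prod_eq_one fun i _ => airyCoeff_self i
  have hprod : (Matrix.of fun ℓ j : Fin (2 * S) => iteratedDeriv (ℓ : ℕ) f (x j)) =
      L * M.transpose.submatrix (unriffle S) id := by
    ext ℓ j
    rw [Matrix.of_apply, iteratedDeriv_eq_sum_airyCoeff hf hairy ℓ.isLt, Matrix.mul_apply,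
      ← Fin.sum_univ_eq_sum_range (fun n => airyCoeff ℓ n * interleaved f n (x j))]
    refine Finset.sum_congr rfl fun n _ => congrArg _ ?_
    by_cases hn : (n : ℕ) % 2 = 0
    · simp [hM, interleaved, unriffle, hn, show (n : ℕ) / 2 < S by omega]
    · simp [hM, interleaved, unriffle, hn]
  rw [hprod, Matrix.det_mul, hL, one_mul, Matrix.det_permute, Matrix.det_transpose, sign_unriffle]
  simp
end

section
/- Let f : ℂ → ℂ be an entire function satisfying f″(z) = z·f(z) for all z ∈ ℂ, let S ≥ 1, and let γ_1,…,γ_S, β_1,…,β_S be complex numbers with γ_ℓ ≠ β_j for all ℓ, j. Write x = (x_1,…,x_{2S}) := (γ_1,…,γ_S, β_1,…,β_S) and, for a tuple v of length m, set Δ(v) := ∏_{1≤j<k≤m}(v_j − v_k). Then Δ(x) · det[ (f(γ_ℓ) f′(β_j) − f′(γ_ℓ) f(β_j)) / (γ_ℓ − β_j) ]_{ℓ,j=1}^S = Δ(γ) Δ(β) · det[ f^{(ℓ−1)}(x_j) ]_{ℓ,j=1}^{2S}. -/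
open Finset

/-- The Vandermonde-type product `Δ(v) = ∏_{j<k} (v_j - v_k)`. -/
noncomputable def vdmC {m : ℕ} (v : Fin m → ℂ) : ℂ :=
  ∏ p ∈ Finset.univ.filter (fun p : Fin m × Fin m => p.1 < p.2), (v p.1 - v p.2)

/-- A product over increasing pairs of `Fin (m + n)` splits into the two blocks and the mixed
pairs. -/
lemma prod_lt_univ_add {M : Type*} [CommMonoid M] {m n : ℕ} (g : Fin (m + n) → Fin (m + n) → M) :
    (∏ i, ∏ j, if i < j then g i j else 1) =
      (∏ i, ∏ j, if i < j then g (Fin.castAdd n i) (Fin.castAdd n j) else 1) *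
      (∏ i, ∏ j, if i < j then g (Fin.natAdd m i) (Fin.natAdd m j) else 1) *
      ∏ i, ∏ j, g (Fin.castAdd n i) (Fin.natAdd m j) := by
  have h1 : ∀ (i : Fin m) (j : Fin n), Fin.castAdd n i < Fin.natAdd m j := fun i j => by
    simp only [Fin.lt_def, Fin.val_castAdd, Fin.val_natAdd]; omega
  have h2 : ∀ (i : Fin m) (j : Fin n), ¬ Fin.natAdd m j < Fin.castAdd n i := fun i j =>
    (h1 i j).not_gt
  have h3 : ∀ (i j : Fin m), Fin.castAdd n i < Fin.castAdd n j ↔ i < j := fun i j => Iff.rfl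
  have h4 : ∀ (i j : Fin n), Fin.natAdd m i < Fin.natAdd m j ↔ i < j := fun i j => by
    simp only [Fin.lt_def, Fin.val_natAdd]; omega
  simp only [Fin.prod_univ_add, h1, h2, h3, h4, if_true, if_false, Finset.prod_mul_distrib,
    Finset.prod_const_one]
  ac_rfl

lemma vdmC_eq_prod_prod {m : ℕ} (v : Fin m → ℂ) :
    vdmC v = ∏ i, ∏ j, if i < j then v i - v j else 1 := by
  rw [vdmC, Finset.prod_filter, ← Finset.univ_product_univ, Finset.prod_product]

lemma vdmC_append {m n : ℕ} (γ : Fin m → ℂ) (β : Fin n → ℂ) :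
    vdmC (Fin.append γ β) = vdmC γ * vdmC β * ∏ i, ∏ j, (γ i - β j) := by
  simp only [vdmC_eq_prod_prod, prod_lt_univ_add, Fin.append_left, Fin.append_right]

lemma vdmC_eq_zero_of_not_injective {m : ℕ} {v : Fin m → ℂ} (hv : ¬ Function.Injective v) :
    vdmC v = 0 := by
  obtain ⟨i, j, hij, hne⟩ := Function.not_injective_iff.mp hv
  rcases lt_or_gt_of_ne hne with h | h
  · exact Finset.prod_eq_zero (i := (i, j)) (by simpa using h) (by simp [hij])
  · exact Finset.prod_eq_zero (i := (j, i)) (by simpa using h) (by simp [hij])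

lemma Matrix.det_fromBlocks_of_commute {R n : Type*} [CommRing R] [IsDomain R] [Fintype n]
    [DecidableEq n] {A C : Matrix n n R} (B D : Matrix n n R) (hAC : Commute A C)
    (hA : A.det ≠ 0) :
    (Matrix.fromBlocks A B C D).det = (A * D - C * B).det := by
  have h : Matrix.fromBlocks 1 0 (-C) A * Matrix.fromBlocks A B C D =
      Matrix.fromBlocks A B 0 (A * D - C * B) := by
    rw [Matrix.fromBlocks_multiply]
    congr 1 <;> simp [hAC.eq, sub_eq_neg_add]
  have h' := congrArg Matrix.det h
  rw [Matrix.det_mul, Matrix.det_fromBlocks_zero₁₂, Matrix.det_fromBlocks_zero₂₁,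
    Matrix.det_one, one_mul] at h'
  exact mul_left_cancel₀ hA h'

open Polynomial in
lemma Matrix.det_fromBlocks_diagonal {R n : Type*} [CommRing R] [IsDomain R] [Fintype n]
    [DecidableEq n] (a c : n → R) (B D : Matrix n n R) :
    (Matrix.fromBlocks (Matrix.diagonal a) B (Matrix.diagonal c) D).det =
      (Matrix.diagonal a * D - Matrix.diagonal c * B).det := by
  have key := Matrix.det_fromBlocks_of_commute
    (A := Matrix.diagonal fun i => (X + C (a i) : R[X])) (C := Matrix.diagonal fun i => C (c i))
    (B.map C) (D.map C) (by
      rw [commute_iff_eq, Matrix.diagonal_mul_diagonal, Matrix.diagonal_mul_diagonal]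
      simp only [mul_comm]) (by
      rw [Matrix.det_diagonal]
      exact Finset.prod_ne_zero_iff.mpr fun i _ => X_add_C_ne_zero (a i))
  have h := congrArg (evalRingHom (0 : R)) key
  rw [RingHom.map_det, RingHom.map_det] at h
  convert h using 2
  · ext (i | i) (j | j)
    case' inl.inl | inr.inl => by_cases hij : i = j
    all_goals simp [*]
  · ext i j
    simp [Matrix.diagonal_mul]

/-- The matrix of Lagrange basis polynomials at `γ`, evaluated at `β`. -/
noncomputable def lagrangeMatrix {S : ℕ} (γ β : Fin S → ℂ) : Matrix (Fin S) (Fin S) ℂ :=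
  Matrix.of fun l j => (Lagrange.basis Finset.univ γ l).eval (β j)

lemma vandermonde_transpose_mul_lagrangeMatrix {S : ℕ} {γ : Fin S → ℂ}
    (hγ : Function.Injective γ) (β : Fin S → ℂ) :
    (Matrix.vandermonde γ).transpose * lagrangeMatrix γ β =
      (Matrix.vandermonde β).transpose := by
  ext k j
  have h := Lagrange.eq_interpolate (s := Finset.univ) (v := γ)
    (f := (Polynomial.X : Polynomial ℂ) ^ (k : ℕ)) hγ.injOn (by
      rw [Polynomial.degree_X_pow, Finset.card_univ, Fintype.card_fin]
      exact_mod_cast k.2)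
  have h' := congrArg (Polynomial.eval (β j)) h
  simp only [Lagrange.interpolate_apply, Polynomial.eval_finsetSum, Polynomial.eval_mul,
    Polynomial.eval_C, Polynomial.eval_pow, Polynomial.eval_X] at h'
  simp [Matrix.mul_apply, lagrangeMatrix, Matrix.vandermonde_apply, h']

lemma lagrangeMatrix_apply {S : ℕ} {γ β : Fin S → ℂ} (hd : ∀ l j, γ l ≠ β j) (l j : Fin S) :
    lagrangeMatrix γ β l j =
      (∏ m ∈ Finset.univ.erase l, (γ l - γ m))⁻¹ *
        ((∏ m, (β j - γ m)) / (β j - γ l)) := by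
  have h : (β j - γ l) ≠ 0 := sub_ne_zero.mpr (hd l j).symm
  rw [← Finset.mul_prod_erase _ (fun m => β j - γ m) (Finset.mem_univ l),
    mul_div_cancel_left₀ _ h]
  simp [lagrangeMatrix, Lagrange.basis, Polynomial.eval_prod, Lagrange.basisDivisor,
    Finset.prod_mul_distrib]

lemma det_diagonal_mul_lagrangeMatrix {S : ℕ} {γ β : Fin S → ℂ} (hd : ∀ l j, γ l ≠ β j)
    (a b a' b' : Fin S → ℂ) :
    (Matrix.diagonal a * (lagrangeMatrix γ β * Matrix.diagonal b') -
        Matrix.diagonal b * (lagrangeMatrix γ β * Matrix.diagonal a')).det =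
      (∏ l, ∏ m ∈ Finset.univ.erase l, (γ l - γ m))⁻¹ * (∏ l, ∏ j, (γ l - β j)) *
        (Matrix.of fun l j => (a l * b' j - b l * a' j) / (γ l - β j)).det := by
  have hM : Matrix.diagonal a * (lagrangeMatrix γ β * Matrix.diagonal b') -
      Matrix.diagonal b * (lagrangeMatrix γ β * Matrix.diagonal a') =
      Matrix.of fun l j => (∏ m ∈ Finset.univ.erase l, (γ l - γ m))⁻¹ *
        (Matrix.of fun l j => ((-1) ^ (S + 1) * ∏ m, (γ m - β j)) *
          (Matrix.of fun l j => (a l * b' j - b l * a' j) / (γ l - β j)) l j) l j := by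
    ext l j
    have h : β j - γ l ≠ 0 := sub_ne_zero.mpr (hd l j).symm
    have hP : ∏ m, (γ m - β j) = (-1) ^ S * ∏ m, (β j - γ m) := by
      rw [← Fin.prod_const, ← Finset.prod_mul_distrib]
      simp
    have hs : (-1 : ℂ) ^ (S + 1) * ((-1) ^ S * ∏ m, (β j - γ m)) = -∏ m, (β j - γ m) := by
      rw [← mul_assoc, ← pow_add, Odd.neg_one_pow ⟨S, by ring⟩, neg_one_mul]
    simp only [Matrix.sub_apply, Matrix.diagonal_mul, Matrix.mul_diagonal, Matrix.of_apply,
      lagrangeMatrix_apply hd, hP, hs]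
    rw [← neg_sub (β j) (γ l)]
    field_simp
  rw [hM, Matrix.det_mul_column, Matrix.det_mul_row, Finset.prod_mul_distrib, Finset.prod_const,
    ← pow_mul, Finset.card_univ, Fintype.card_fin, mul_comm (S + 1),
    (Nat.even_mul_succ_self S).neg_one_pow, one_mul, Finset.prod_inv_distrib, mul_assoc,
    Finset.prod_comm (f := fun l j => γ l - β j)]

/-- The permutation listing the even indices first and the odd ones afterwards. -/
noncomputable def evenOddPerm (S : ℕ) : Equiv.Perm (Fin (S + S)) :=
  Equiv.ofBijective
    (Fin.append (fun k : Fin S => (⟨2 * k, by omega⟩ : Fin (S + S)))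
      (fun k : Fin S => (⟨2 * k + 1, by omega⟩ : Fin (S + S)))) <|
    Finite.injective_iff_bijective.mp <| by
      intro i j
      refine Fin.addCases (fun i => ?_) (fun i => ?_) i <;>
        refine Fin.addCases (fun j => ?_) (fun j => ?_) j <;>
        simp only [Fin.append_left, Fin.append_right, Fin.ext_iff, Fin.val_castAdd,
          Fin.val_natAdd] <;> omega

lemma evenOddPerm_castAdd {S : ℕ} (k : Fin S) :
    ((evenOddPerm S (Fin.castAdd S k) : Fin (S + S)) : ℕ) = 2 * k := by
  simp [evenOddPerm]

lemma evenOddPerm_natAdd {S : ℕ} (k : Fin S) :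
    ((evenOddPerm S (Fin.natAdd S k) : Fin (S + S)) : ℕ) = 2 * k + 1 := by
  simp [evenOddPerm, -Fin.natAdd_eq_addNat]

lemma sign_evenOddPerm (S : ℕ) :
    ((Equiv.Perm.sign (evenOddPerm S) : ℤˣ) : ℤ) =
      ∏ i : Fin S, ∏ j : Fin S, if i < j then -1 else 1 := by
  have h : Equiv.Perm.sign (evenOddPerm S) =
      ∏ i, ∏ j, if i < j then (if evenOddPerm S i < evenOddPerm S j then (1 : ℤˣ) else -1)
        else 1 := by
    rw [Equiv.Perm.sign_eq_prod_prod_Ioi]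
    refine Finset.prod_congr rfl fun i _ => ?_
    rw [← Finset.prod_filter]
    congr 1
    ext j
    simp
  have h1 : ∀ i j : Fin S, (if i < j then
      (if 2 * (i : ℕ) < 2 * j then (1 : ℤˣ) else -1) else 1) = 1 := fun i j => by
    split_ifs with h h' <;> first | rfl | (rw [Fin.lt_def] at h; omega)
  have h2 : ∀ i j : Fin S, (if i < j then
      (if 2 * (i : ℕ) + 1 < 2 * j + 1 then (1 : ℤˣ) else -1) else 1) = 1 := fun i j => by
    split_ifs with h h' <;> first | rfl | (rw [Fin.lt_def] at h; omega)
  have h3 : ∀ i j : Fin S, (if 2 * (i : ℕ) < 2 * j + 1 then (1 : ℤˣ) else -1) =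
      if j < i then -1 else 1 := fun i j => by
    simp only [Fin.lt_def]
    split_ifs <;> first | rfl | omega
  rw [h, prod_lt_univ_add]
  simp only [Fin.lt_def (a := evenOddPerm S _), evenOddPerm_castAdd, evenOddPerm_natAdd,
    h1, h2, h3, Finset.prod_const_one, one_mul]
  rw [Finset.prod_comm]
  push_cast
  refine Finset.prod_congr rfl fun i _ => Finset.prod_congr rfl fun j _ => ?_
  split_ifs <;> rfl

lemma sign_mul_det_vandermonde_sq {S : ℕ} (γ : Fin S → ℂ) :
    (((Equiv.Perm.sign (evenOddPerm S) : ℤˣ) : ℤ) : ℂ) * (Matrix.vandermonde γ).det ^ 2 =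
      ∏ l, ∏ m ∈ Finset.univ.erase l, (γ l - γ m) := by
  have hV : (Matrix.vandermonde γ).det = ∏ i, ∏ j, if i < j then γ j - γ i else 1 := by
    rw [Matrix.det_vandermonde]
    refine Finset.prod_congr rfl fun i _ => ?_
    rw [← Finset.prod_filter]
    congr 1
    ext j
    simp
  have hV' : (Matrix.vandermonde γ).det = ∏ i, ∏ j, if j < i then γ i - γ j else 1 := by
    rw [hV, Finset.prod_comm]
  rw [pow_two]
  nth_rewrite 1 [hV]
  rw [hV', sign_evenOddPerm]
  push_cast
  simp only [← Finset.prod_mul_distrib]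
  refine Finset.prod_congr rfl fun i _ => ?_
  rw [← Finset.mul_prod_erase _ _ (Finset.mem_univ i)]
  simp only [lt_irrefl, if_false, mul_one, one_mul]
  refine Finset.prod_congr rfl fun j hj => ?_
  rcases lt_or_gt_of_ne (Finset.ne_of_mem_erase hj) with h | h
  · simp [h, h.not_gt]
  · simp [h, h.not_gt]

/-- `z ^ k * f z` for `n = 2 * k` and `z ^ k * f' z` for `n = 2 * k + 1`. -/
noncomputable def powMulDeriv (f : ℂ → ℂ) (n : ℕ) (z : ℂ) : ℂ :=
  z ^ (n / 2) * iteratedDeriv (n % 2) f z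

lemma hasDerivAt_powMulDeriv {f : ℂ → ℂ} (hf : Differentiable ℂ f)
    (hairy : ∀ z : ℂ, iteratedDeriv 2 f z = z * f z) (n : ℕ) (z : ℂ) :
    HasDerivAt (powMulDeriv f n)
      (powMulDeriv f (n + 1) z + (n / 2 : ℕ) * powMulDeriv f (n - 2) z) z := by
  have h0 : HasDerivAt f (deriv f z) z := (hf z).hasDerivAt
  have h1 : HasDerivAt (deriv f) (z * f z) z := by
    have := ((hf.contDiff (n := 2)).differentiable_deriv_two z).hasDerivAt
    rw [← hairy z, iteratedDeriv_succ, iteratedDeriv_one]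
    exact this
  obtain ⟨k, rfl | rfl⟩ := Nat.even_or_odd' n
  · have e : powMulDeriv f (2 * k) = fun z => z ^ k * f z := by
      funext w; simp [powMulDeriv]
    rw [e]
    refine ((hasDerivAt_pow k z).fun_mul h0).congr_deriv ?_
    rcases k with _ | k
    · simp [powMulDeriv]
    · have a1 : (2 * (k + 1) + 1) / 2 = k + 1 := by omega
      have a2 : (2 * (k + 1) + 1) % 2 = 1 := by omega
      have a3 : 2 * (k + 1) - 2 = 2 * k := by omega
      simp [powMulDeriv, a1, a2, a3]
      ring
  · have e : powMulDeriv f (2 * k + 1) = fun z => z ^ k * deriv f z := by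
      funext w
      have a1 : (2 * k + 1) / 2 = k := by omega
      have a2 : (2 * k + 1) % 2 = 1 := by omega
      simp [powMulDeriv, a1, a2]
    rw [e]
    refine ((hasDerivAt_pow k z).fun_mul h1).congr_deriv ?_
    have a1 : (2 * k + 1 + 1) / 2 = k + 1 := by omega
    have a2 : (2 * k + 1 + 1) % 2 = 0 := by omega
    have a5 : (2 * k + 1) / 2 = k := by omega
    rcases k with _ | k
    · simp [powMulDeriv]
    · have a3 : 2 * (k + 1) + 1 - 2 = 2 * k + 1 := by omega
      have a4 : (2 * k + 1) / 2 = k := by omega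
      have a6 : (2 * k + 1) % 2 = 1 := by omega
      simp [powMulDeriv, a1, a2, a3, a4, a5, a6]
      ring

lemma iteratedDeriv_sub_powMulDeriv_mem_span {f : ℂ → ℂ} (hf : Differentiable ℂ f)
    (hairy : ∀ z : ℂ, iteratedDeriv 2 f z = z * f z) (n : ℕ) :
    iteratedDeriv n f - powMulDeriv f n ∈
      Submodule.span ℂ (powMulDeriv f '' (Finset.range n : Set ℕ)) := by
  induction n with
  | zero =>
    have : iteratedDeriv 0 f - powMulDeriv f 0 = 0 := by
      funext z; simp [powMulDeriv]
    rw [this]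
    exact zero_mem _
  | succ n ih =>
    obtain ⟨c, hc⟩ := (Submodule.mem_span_image_finset_iff_exists_fun' ℂ).mp ih
    have hD : iteratedDeriv (n + 1) f - powMulDeriv f (n + 1) =
        ∑ m ∈ Finset.range n, c m • (powMulDeriv f (m + 1) +
          ((m / 2 : ℕ) : ℂ) • powMulDeriv f (m - 2)) +
        ((n / 2 : ℕ) : ℂ) • powMulDeriv f (n - 2) := by
      have e : iteratedDeriv n f =
          fun z => ∑ m ∈ Finset.range n, c m * powMulDeriv f m z + powMulDeriv f n z := by
        funext z
        have := congrFun hc z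
        simp only [Finset.sum_apply, Pi.smul_apply, smul_eq_mul, Pi.sub_apply] at this
        rw [this]; ring
      funext z
      have hd := (HasDerivAt.fun_sum (u := Finset.range n) fun m _ =>
        (hasDerivAt_powMulDeriv hf hairy m z).const_mul (c m)).fun_add
          (hasDerivAt_powMulDeriv hf hairy n z)
      rw [← e] at hd
      rw [Pi.sub_apply, iteratedDeriv_succ, hd.deriv]
      simp only [Pi.add_apply, Finset.sum_apply, Pi.smul_apply, smul_eq_mul]
      ring
    have hmem : ∀ m < n + 1, powMulDeriv f m ∈
        Submodule.span ℂ (powMulDeriv f '' (Finset.range (n + 1) : Set ℕ)) := fun m hm =>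
      Submodule.subset_span ⟨m, by simpa using hm, rfl⟩
    rw [hD]
    refine add_mem (sum_mem fun m hm => Submodule.smul_mem _ _
      (add_mem (hmem _ ?_) (Submodule.smul_mem _ _ (hmem _ ?_))))
      (Submodule.smul_mem _ _ (hmem _ ?_))
    all_goals try rw [Finset.mem_range] at hm
    all_goals omega

lemma det_iteratedDeriv_eq_det_powMulDeriv {f : ℂ → ℂ} (hf : Differentiable ℂ f)
    (hairy : ∀ z : ℂ, iteratedDeriv 2 f z = z * f z) {N : ℕ} (x : Fin N → ℂ) :
    (Matrix.of fun l j : Fin N => iteratedDeriv (l : ℕ) f (x j)).det =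
      (Matrix.of fun l j : Fin N => powMulDeriv f l (x j)).det := by
  choose c hc using fun n => (Submodule.mem_span_image_finset_iff_exists_fun' ℂ).mp
    (iteratedDeriv_sub_powMulDeriv_mem_span hf hairy n)
  let L : Matrix (Fin N) (Fin N) ℂ :=
    Matrix.of fun l m => if m < l then c l m else if m = l then 1 else 0
  have hL : L.det = 1 := by
    rw [Matrix.det_of_isLowerTriangular L]
    · simp [L]
    · intro i j hij
      have hij' : i < j := hij
      simp [L, hij'.not_gt, hij'.ne']
  have hM : (Matrix.of fun l j : Fin N => iteratedDeriv (l : ℕ) f (x j)) =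
      L * Matrix.of fun l j : Fin N => powMulDeriv f l (x j) := by
    ext l j
    have h := congrFun (hc l) (x j)
    simp only [Finset.sum_apply, Pi.smul_apply, smul_eq_mul, Pi.sub_apply] at h
    have h1 : ∑ m : Fin N, (if m < l then c l m * powMulDeriv f m (x j) else 0) =
        ∑ m ∈ Finset.range l, c l m * powMulDeriv f m (x j) := by
      have := Fin.sum_univ_eq_sum_range
        (fun m => if m < (l : ℕ) then c l m * powMulDeriv f m (x j) else 0) N
      simp only [Fin.lt_def]
      rw [this, ← Finset.sum_filter]
      congr 1
      ext m
      have := l.2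
      simp only [Finset.mem_filter, Finset.mem_range]
      omega
    have h2 : ∀ m : Fin N, L l m * powMulDeriv f m (x j) =
        (if m < l then c l m * powMulDeriv f m (x j) else 0) +
          if m = l then powMulDeriv f m (x j) else 0 := fun m => by
      rcases lt_trichotomy m l with h | h | h
      · simp [L, h, h.ne]
      · simp [L, h]
      · simp [L, h.not_gt, h.ne']
    rw [Matrix.mul_apply]
    simp only [Matrix.of_apply]
    simp only [h2, Finset.sum_add_distrib, h1, h, Finset.sum_ite_eq', Finset.mem_univ, if_true]
    ring
  rw [hM, Matrix.det_mul, hL, one_mul]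

lemma det_powMulDeriv_append (f : ℂ → ℂ) {S : ℕ} {γ β : Fin S → ℂ}
    (hγ : Function.Injective γ) (hd : ∀ l j, γ l ≠ β j) :
    (Matrix.of fun l j : Fin (S + S) => powMulDeriv f l (Fin.append γ β j)).det =
      (∏ l, ∏ j, (γ l - β j)) *
        (Matrix.of fun l j : Fin S =>
          (f (γ l) * deriv f (β j) - deriv f (γ l) * f (β j)) / (γ l - β j)).det := by
  set M : Matrix (Fin (S + S)) (Fin (S + S)) ℂ :=
    Matrix.of fun l j => powMulDeriv f l (Fin.append γ β j) with hMdef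
  have hperm := Matrix.det_permute (evenOddPerm S) M
  rw [← Matrix.det_submatrix_equiv_self finSumFinEquiv] at hperm
  have hblock : (M.submatrix (evenOddPerm S) id).submatrix finSumFinEquiv finSumFinEquiv =
      Matrix.fromBlocks (Matrix.vandermonde γ).transpose 0 0 (Matrix.vandermonde γ).transpose *
      Matrix.fromBlocks (Matrix.diagonal (f ∘ γ)) (lagrangeMatrix γ β * Matrix.diagonal (f ∘ β))
        (Matrix.diagonal (deriv f ∘ γ))
        (lagrangeMatrix γ β * Matrix.diagonal (deriv f ∘ β)) := by
    rw [Matrix.fromBlocks_multiply]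
    simp only [Matrix.zero_mul, add_zero, zero_add, ← Matrix.mul_assoc,
      vandermonde_transpose_mul_lagrangeMatrix hγ]
    have a1 : ∀ k : ℕ, (2 * k + 1) / 2 = k := fun k => by omega
    have a2 : ∀ k : ℕ, (2 * k + 1) % 2 = 1 := fun k => by omega
    ext (i | i) (j | j) <;>
      simp [-Fin.natAdd_eq_addNat, hMdef, powMulDeriv, evenOddPerm_castAdd, evenOddPerm_natAdd, a1, a2,
        Matrix.mul_diagonal, Matrix.vandermonde_apply]
  rw [hblock, Matrix.det_mul, Matrix.det_fromBlocks_zero₂₁, Matrix.det_fromBlocks_diagonal,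
    det_diagonal_mul_lagrangeMatrix hd, ← sign_mul_det_vandermonde_sq,
    Matrix.det_transpose] at hperm
  have hV : (Matrix.vandermonde γ).det ≠ 0 := Matrix.det_vandermonde_ne_zero_iff.mpr hγ
  have hs : (((Equiv.Perm.sign (evenOddPerm S) : ℤˣ) : ℤ) : ℂ) ≠ 0 := by
    exact_mod_cast (Equiv.Perm.sign (evenOddPerm S)).ne_zero
  have hs2 : (((Equiv.Perm.sign (evenOddPerm S) : ℤˣ) : ℤ) : ℂ) ^ 2 = 1 := by
    rw [← Int.cast_pow, ← Units.val_pow_eq_pow_val, Int.units_sq]; simp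
  simp only [Function.comp_apply] at hperm
  field_simp at hperm
  rw [hs2, one_mul] at hperm
  exact hperm.symm

/-- the Airy-kernel determinant identity
`Δ(x) · det[K_Ai(γ_ℓ, β_j)] = Δ(γ) Δ(β) · det[f^{(ℓ-1)}(x_j)]`
(Theorem 1.1 / Remark 3.2 of the paper). -/
theorem stmt_4 (f : ℂ → ℂ) (hf : Differentiable ℂ f)
    (hairy : ∀ z : ℂ, iteratedDeriv 2 f z = z * f z)
    (S : ℕ) (hS : 1 ≤ S) (γ β : Fin S → ℂ)
    (hd : ∀ ℓ j, γ ℓ ≠ β j) :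
    vdmC (Fin.append γ β) *
      Matrix.det (Matrix.of fun ℓ j : Fin S =>
        (f (γ ℓ) * deriv f (β j) - deriv f (γ ℓ) * f (β j)) / (γ ℓ - β j))
    = vdmC γ * vdmC β *
      Matrix.det (Matrix.of fun ℓ j : Fin (S + S) =>
        iteratedDeriv (ℓ : ℕ) f (Fin.append γ β j)) := by
  by_cases hγ : Function.Injective γ
  · rw [det_iteratedDeriv_eq_det_powMulDeriv hf hairy, det_powMulDeriv_append f hγ hd, vdmC_append,
      mul_assoc]
  · rw [vdmC_append, vdmC_eq_zero_of_not_injective hγ]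
    simp only [zero_mul]
end

section
/- Let S ≥ 1, ν ∈ ℤ, let f_μ : ℂ → ℂ (μ ∈ ℤ) be a family of functions, and let y_1,…,y_{2S} be complex numbers such that y_j·f_μ(y_j) = (μ − 1)·f_{μ−1}(y_j) − f_{μ−2}(y_j) for every μ ∈ ℤ and every 1 ≤ j ≤ 2S. Define the 2S × 2S matrix M by: for 0 ≤ k ≤ S − 1 and 1 ≤ j ≤ 2S, the entry in row 2k+1, column j is y_j^k f_ν(y_j), and the entry in row 2k+2, column j is y_j^k (f_{ν−1}(y_j) − (ν/2) f_ν(y_j)). Then det M = det[ f_{ν−ℓ+1}(y_j) ]_{ℓ=1,…,2S; j=1,…,2S}. -/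
/-- The coefficients of `f (μ - i)` in the expansion of `x ^ k * f μ` for a family satisfying
`x * f μ = (μ - 1) * f (μ - 1) - f (μ - 2)`. -/
def shiftCoeff : ℕ → ℤ → ℕ → ℂ
  | 0, _, 0 => 1
  | 0, _, _ + 1 => 0
  | _ + 1, _, 0 => 0
  | k + 1, μ, 1 => ((μ : ℂ) - 1) * shiftCoeff k (μ - 1) 0
  | k + 1, μ, i + 2 => ((μ : ℂ) - 1) * shiftCoeff k (μ - 1) (i + 1) - shiftCoeff k (μ - 2) i

theorem shiftCoeff_eq_zero (k : ℕ) (μ : ℤ) (i : ℕ) (h : 2 * k < i) : shiftCoeff k μ i = 0 := by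
  induction k generalizing μ i with
  | zero =>
    obtain ⟨i, rfl⟩ := Nat.exists_eq_add_of_lt h
    simp [shiftCoeff]
  | succ k ih =>
    obtain ⟨i, rfl⟩ := Nat.exists_eq_add_of_le' (show 2 ≤ i by omega)
    rw [shiftCoeff, ih _ _ (by omega), ih _ _ (by omega)]
    simp

theorem shiftCoeff_two_mul (k : ℕ) (μ : ℤ) : shiftCoeff k μ (2 * k) = (-1) ^ k := by
  induction k generalizing μ with
  | zero => simp [shiftCoeff]
  | succ k ih =>
    rw [mul_add, mul_one, shiftCoeff, ih, shiftCoeff_eq_zero _ _ _ (by omega)]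
    ring

theorem pow_mul_eq_sum_shiftCoeff {g : ℤ → ℂ} {x : ℂ}
    (h : ∀ μ : ℤ, x * g μ = ((μ : ℂ) - 1) * g (μ - 1) - g (μ - 2)) (k : ℕ) (μ : ℤ) (n : ℕ)
    (hn : 2 * k < n) : x ^ k * g μ = ∑ i ∈ Finset.range n, shiftCoeff k μ i * g (μ - i) := by
  induction k generalizing μ n with
  | zero =>
    obtain ⟨n, rfl⟩ := Nat.exists_eq_add_of_le' (show 1 ≤ n by omega)
    simp [Finset.sum_range_succ', shiftCoeff]
  | succ k ih =>
    obtain ⟨n, rfl⟩ := Nat.exists_eq_add_of_le' (show 2 ≤ n by omega)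
    have e₁ (i : ℕ) : μ - 1 - ((i + 1 : ℕ) : ℤ) = μ - ((i + 1 + 1 : ℕ) : ℤ) := by push_cast; ring
    have e₂ (i : ℕ) : μ - 2 - (i : ℤ) = μ - ((i + 1 + 1 : ℕ) : ℤ) := by push_cast; ring
    have h₁ := ih (μ - 1) (n + 1) (by omega)
    have h₂ := ih (μ - 2) n (by omega)
    rw [Finset.sum_range_succ'] at h₁
    simp only [e₁] at h₁
    simp only [e₂] at h₂
    rw [pow_succ, mul_assoc, h, mul_sub, mul_left_comm, h₁, h₂, Finset.sum_range_succ',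
      Finset.sum_range_succ']
    simp only [shiftCoeff, sub_mul, Finset.sum_sub_distrib, mul_assoc, ← Finset.mul_sum]
    simp
    ring

/-- The coefficients of `f (ν - i)` in row `r` of the interleaved matrix. -/
noncomputable def interleavedCoeff (ν : ℤ) (r i : ℕ) : ℂ :=
  if r % 2 = 0 then shiftCoeff (r / 2) ν i
  else (if i = 0 then 0 else shiftCoeff (r / 2) (ν - 1) (i - 1))
    - (ν : ℂ) / 2 * shiftCoeff (r / 2) ν i

theorem interleavedCoeff_eq_zero (ν : ℤ) {r i : ℕ} (h : r < i) : interleavedCoeff ν r i = 0 := by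
  unfold interleavedCoeff
  rw [shiftCoeff_eq_zero _ _ _ (by omega)]
  split_ifs
  · rfl
  · simp
  · rw [shiftCoeff_eq_zero _ _ _ (by omega)]
    simp

theorem interleavedCoeff_self (ν : ℤ) (r : ℕ) : interleavedCoeff ν r r = (-1) ^ (r / 2) := by
  unfold interleavedCoeff
  split_ifs with h₁ h₂
  · conv_lhs => rw [show r = 2 * (r / 2) by omega]
    simp [shiftCoeff_two_mul]
  · omega
  · rw [shiftCoeff_eq_zero _ ν _ (by omega), show r - 1 = 2 * (r / 2) by omega,
      shiftCoeff_two_mul]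
    simp

theorem sum_interleavedCoeff {g : ℤ → ℂ} {x : ℂ}
    (h : ∀ μ : ℤ, x * g μ = ((μ : ℂ) - 1) * g (μ - 1) - g (μ - 2)) (ν : ℤ) {r n : ℕ}
    (hr : r < n) :
    ∑ i ∈ Finset.range n, interleavedCoeff ν r i * g (ν - i) =
      if r % 2 = 0 then x ^ (r / 2) * g ν
      else x ^ (r / 2) * (g (ν - 1) - (ν : ℂ) / 2 * g ν) := by
  unfold interleavedCoeff
  split_ifs with h₁
  · exact (pow_mul_eq_sum_shiftCoeff h _ _ _ (by omega)).symm
  · obtain ⟨n, rfl⟩ := Nat.exists_eq_add_of_le' (show 1 ≤ n by omega)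
    have e (i : ℕ) : ν - 1 - (i : ℤ) = ν - ((i + 1 : ℕ) : ℤ) := by push_cast; ring
    have h₂ := pow_mul_eq_sum_shiftCoeff h (r / 2) (ν - 1) n (by omega)
    simp only [e] at h₂
    rw [mul_sub, mul_left_comm, h₂, pow_mul_eq_sum_shiftCoeff h (r / 2) ν (n + 1) (by omega)]
    simp only [sub_mul, Finset.sum_sub_distrib, mul_assoc, ← Finset.mul_sum]
    rw [Finset.sum_range_succ']
    simp

theorem prod_range_neg_one_pow_half (S : ℕ) :
    ∏ r ∈ Finset.range (2 * S), (-1 : ℂ) ^ (r / 2) = 1 := by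
  induction S with
  | zero => simp
  | succ S ih =>
    rw [mul_add, mul_one, Finset.prod_range_succ, Finset.prod_range_succ, ih,
      show (2 * S + 1) / 2 = S by omega, show 2 * S / 2 = S by omega, one_mul, ← mul_pow]
    simp

/-- row-reduction step (equation (3.16) of the paper): the interleaved
matrix of monomial multiples of `f_ν` and `f_{ν-1} - (ν/2) f_ν` has the same
determinant as the matrix of the shifted functions `f_{ν-ℓ+1}`. -/
theorem stmt_7 (S : ℕ) (hS : 1 ≤ S) (ν : ℤ) (f : ℤ → ℂ → ℂ)
    (y : Fin (2 * S) → ℂ)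
    (hrec : ∀ (μ : ℤ) (j : Fin (2 * S)),
      y j * f μ (y j) = ((μ : ℂ) - 1) * f (μ - 1) (y j) - f (μ - 2) (y j)) :
    Matrix.det (Matrix.of fun r j : Fin (2 * S) =>
      if (r : ℕ) % 2 = 0 then y j ^ ((r : ℕ) / 2) * f ν (y j)
      else y j ^ ((r : ℕ) / 2) * (f (ν - 1) (y j) - ((ν : ℂ) / 2) * f ν (y j)))
    = Matrix.det (Matrix.of fun ℓ j : Fin (2 * S) => f (ν - (ℓ : ℕ)) (y j)) := by
  have hdet : (Matrix.of fun r i : Fin (2 * S) => interleavedCoeff ν r i).det = 1 := by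
    rw [Matrix.det_of_isLowerTriangular (Matrix.of fun r i : Fin (2 * S) => interleavedCoeff ν r i)
      fun r i hri => interleavedCoeff_eq_zero ν (r := (r : ℕ)) (i := (i : ℕ)) hri]
    simp only [Matrix.of_apply, interleavedCoeff_self]
    rw [Fin.prod_univ_eq_prod_range (fun r => (-1 : ℂ) ^ (r / 2)), prod_range_neg_one_pow_half]
  rw [← one_mul (Matrix.det (Matrix.of fun ℓ j : Fin (2 * S) => f (ν - (ℓ : ℕ)) (y j))), ← hdet,
    ← Matrix.det_mul]
  congr 1
  ext r j
  simp only [Matrix.mul_apply, Matrix.of_apply]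
  rw [Fin.sum_univ_eq_sum_range (fun i => interleavedCoeff ν r i * f (ν - i) (y j))]
  exact (sum_interleavedCoeff (g := fun μ => f μ (y j)) (fun μ => hrec μ j) ν r.isLt).symm
end

section
/- Let n ≥ 1 and let λ_1,…,λ_n be complex numbers. Then ∫_{ℝ^n} ( ∏_{1≤j<k≤n} (x_k − x_j) ) · det[ e^{x_j λ_k} ]_{j,k=1}^n · ∏_{j=1}^n e^{−x_j²/2} dx_1 ⋯ dx_n = n! · (2π)^{n/2} · e^{(1/2) Σ_{ℓ=1}^n λ_ℓ²} · ∏_{1≤ℓ<m≤n} (λ_m − λ_ℓ). -/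
open Finset MeasureTheory

/-- Every moment of an exponentially tilted Gaussian is absolutely integrable. -/
theorem integrable_pow_mul_cexp_sub_sq_div_two (k : ℕ) (z : ℂ) :
    Integrable fun x : ℝ => (x : ℂ) ^ k * Complex.exp (x * z - x ^ 2 / 2) := by
  have hE (w : ℂ) : Integrable fun x : ℝ => Complex.exp (x * w - x ^ 2 / 2) := by
    convert! integrable_cexp_quadratic' (b := -1 / 2) (by norm_num) w 0 using 3
    ring
  have hB := (((hE (z + 1)).norm.add (hE (z - 1)).norm).const_mul (k.factorial : ℝ))
  refine hB.mono' (by fun_prop) (.of_forall fun x => ?_)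
  have h1 : |x| ^ k ≤ k.factorial * Real.exp |x| := by
    have := Real.pow_div_factorial_le_exp |x| (abs_nonneg x) k
    rwa [div_le_iff₀' (by positivity)] at this
  have h2 : Real.exp |x| ≤ Real.exp x + Real.exp (-x) := by
    rcases abs_cases x with ⟨h, _⟩ | ⟨h, _⟩ <;> rw [h] <;>
      linarith [Real.exp_pos x, Real.exp_pos (-x)]
  have h3 : |x| ^ k ≤ k.factorial * (Real.exp x + Real.exp (-x)) :=
    h1.trans (by gcongr)
  have e1 : Complex.exp (x * (z + 1) - x ^ 2 / 2)
      = Complex.exp x * Complex.exp (x * z - x ^ 2 / 2) := by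
    rw [← Complex.exp_add]; ring_nf
  have e2 : Complex.exp (x * (z - 1) - x ^ 2 / 2)
      = Complex.exp ((-x : ℝ) : ℂ) * Complex.exp (x * z - x ^ 2 / 2) := by
    rw [← Complex.exp_add]; push_cast; ring_nf
  simp only [Pi.add_apply, e1, e2, norm_mul, norm_pow, Complex.norm_real, Real.norm_eq_abs,
    Complex.norm_exp_ofReal]
  rw [← add_mul, ← mul_assoc]
  gcongr

/-- Three-term recursion of the Gaussian moments, obtained by integration by parts. -/
theorem integral_pow_succ_mul_cexp_sub_sq_div_two (k : ℕ) (z : ℂ) :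
    ∫ x : ℝ, (x : ℂ) ^ (k + 1) * Complex.exp (x * z - x ^ 2 / 2)
      = z * (∫ x : ℝ, (x : ℂ) ^ k * Complex.exp (x * z - x ^ 2 / 2))
        + k * ∫ x : ℝ, (x : ℂ) ^ (k - 1) * Complex.exp (x * z - x ^ 2 / 2) := by
  have hI (m : ℕ) := integrable_pow_mul_cexp_sub_sq_div_two m z
  have hderiv (x : ℝ) : HasDerivAt (fun x : ℝ => (x : ℂ) ^ k * Complex.exp (x * z - x ^ 2 / 2))
      ((z * ((x : ℂ) ^ k * Complex.exp (x * z - x ^ 2 / 2))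
        + k * ((x : ℂ) ^ (k - 1) * Complex.exp (x * z - x ^ 2 / 2)))
        - (x : ℂ) ^ (k + 1) * Complex.exp (x * z - x ^ 2 / 2)) x := by
    have h : HasDerivAt (fun y : ℂ => y ^ k * Complex.exp (y * z - y ^ 2 / 2)) _ (x : ℂ) :=
      (hasDerivAt_pow k (x : ℂ)).mul
        ((((hasDerivAt_id' (x : ℂ)).mul_const z).sub
          ((hasDerivAt_pow 2 (x : ℂ)).div_const 2)).cexp)
    convert! h.comp_ofReal using 1
    simp
    ring
  have h12 : Integrable fun x : ℝ => z * ((x : ℂ) ^ k * Complex.exp (x * z - x ^ 2 / 2))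
      + k * ((x : ℂ) ^ (k - 1) * Complex.exp (x * z - x ^ 2 / 2)) :=
    ((hI k).const_mul z).add ((hI (k - 1)).const_mul (k : ℂ))
  have h0 := integral_eq_zero_of_hasDerivAt_of_integrable hderiv (h12.sub (hI (k + 1))) (hI k)
  rw [integral_sub h12 (hI (k + 1)),
    integral_add ((hI k).const_mul z) ((hI (k - 1)).const_mul (k : ℂ)),
    integral_const_mul, integral_const_mul, sub_eq_zero] at h0
  exact h0.symm

theorem integral_cexp_sub_sq_div_two (z : ℂ) :
    ∫ x : ℝ, Complex.exp (x * z - x ^ 2 / 2)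
      = (Real.sqrt (2 * Real.pi) : ℂ) * Complex.exp (z ^ 2 / 2) := by
  have h := integral_cexp_quadratic (b := -1 / 2) (by norm_num) z 0
  have hs : (Real.sqrt (2 * Real.pi) : ℂ) = (Real.pi / -(-1 / 2) : ℂ) ^ (1 / 2 : ℂ) := by
    rw [Real.sqrt_eq_rpow, Complex.ofReal_cpow (by positivity)]
    push_cast
    ring_nf
  rw [hs]
  convert! h using 3
  · ring_nf
  · ring

open Polynomial in
/-- The Gaussian moment of order `k`, as a function of the shift, is a monic polynomial of degree
`k` times the Gaussian. -/
theorem exists_monic_integral_pow_mul_cexp_sub_sq_div_two (k : ℕ) :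
    ∃ p : ℂ[X], p.Monic ∧ p.natDegree = k ∧ ∀ z : ℂ,
      ∫ x : ℝ, (x : ℂ) ^ k * Complex.exp (x * z - x ^ 2 / 2)
        = (Real.sqrt (2 * Real.pi) : ℂ) * Complex.exp (z ^ 2 / 2) * p.eval z := by
  induction k using Nat.twoStepInduction with
  | zero => exact ⟨1, monic_one, natDegree_one, fun z => by simp [integral_cexp_sub_sq_div_two]⟩
  | one =>
    refine ⟨X, monic_X, natDegree_X, fun z => ?_⟩
    rw [integral_pow_succ_mul_cexp_sub_sq_div_two 0 z]
    simp [integral_cexp_sub_sq_div_two]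
    ring
  | more k ih0 ih1 =>
    obtain ⟨p, hp, hpd, hpi⟩ := ih0
    obtain ⟨q, hq, hqd, hqi⟩ := ih1
    have hXq : (X * q).Monic := monic_X.mul hq
    have hXqd : (X * q).natDegree = k + 2 := by
      rw [natDegree_X_mul hq.ne_zero, hqd]
    have hlt : (C ((k : ℂ) + 1) * p).natDegree < (X * q).natDegree := by
      have := natDegree_C_mul_le ((k : ℂ) + 1) p
      omega
    refine ⟨X * q + C ((k : ℂ) + 1) * p, hXq.add_of_left (degree_lt_degree hlt), ?_, fun z => ?_⟩
    · rw [natDegree_add_eq_left_of_natDegree_lt hlt, hXqd]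
    · rw [integral_pow_succ_mul_cexp_sub_sq_div_two (k + 1) z, Nat.add_sub_cancel, hpi, hqi]
      simp
      ring

/-- **Andréief's identity**: the integral of a product of two determinants is a determinant of
integrals. -/
theorem integral_det_mul_det {ι E 𝕜 : Type*} [Fintype ι] [DecidableEq ι] [RCLike 𝕜]
    [MeasurableSpace E] (μ : Measure E) [SigmaFinite μ] (f g : ι → E → 𝕜)
    (hfg : ∀ i j, Integrable (fun x => f i x * g j x) μ) :
    ∫ x : ι → E, (Matrix.of fun j k => f k (x j)).det * (Matrix.of fun j k => g k (x j)).det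
        ∂(Measure.pi fun _ => μ)
      = ((Fintype.card ι).factorial : 𝕜) *
        (Matrix.of fun i j => ∫ x, f i x * g j x ∂μ).det := by
  set A : Matrix ι ι 𝕜 := Matrix.of fun i j => ∫ x, f i x * g j x ∂μ
  have hexp (x : ι → E) :
      (Matrix.of fun j k => f k (x j)).det * (Matrix.of fun j k => g k (x j)).det
        = ∑ σ : Equiv.Perm ι, ∑ τ : Equiv.Perm ι,
          ((Equiv.Perm.sign σ : ℤ) : 𝕜) * ((Equiv.Perm.sign τ : ℤ) : 𝕜) *
            ∏ j, (f (σ j) (x j) * g (τ j) (x j)) := by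
    rw [← Matrix.det_transpose, ← Matrix.det_transpose (Matrix.of fun j k => g k (x j)),
      Matrix.det_apply', Matrix.det_apply', Finset.sum_mul_sum]
    refine Finset.sum_congr rfl fun σ _ => Finset.sum_congr rfl fun τ _ => ?_
    simp only [Matrix.transpose_apply, Matrix.of_apply, Finset.prod_mul_distrib]
    ring
  have hint (σ τ : Equiv.Perm ι) :
      Integrable (fun x : ι → E => ((Equiv.Perm.sign σ : ℤ) : 𝕜) * ((Equiv.Perm.sign τ : ℤ) : 𝕜) *
        ∏ j, (f (σ j) (x j) * g (τ j) (x j))) (Measure.pi fun _ => μ) :=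
    (Integrable.fintype_prod (f := fun j y => f (σ j) y * g (τ j) y)
      fun j => hfg (σ j) (τ j)).const_mul _
  simp_rw [hexp]
  rw [integral_finsetSum _ fun σ _ => integrable_finsetSum _ fun τ _ => hint σ τ]
  have hterm (σ : Equiv.Perm ι) :
      ∫ x : ι → E, ∑ τ : Equiv.Perm ι,
          ((Equiv.Perm.sign σ : ℤ) : 𝕜) * ((Equiv.Perm.sign τ : ℤ) : 𝕜) *
            ∏ j, (f (σ j) (x j) * g (τ j) (x j)) ∂(Measure.pi fun _ => μ) = A.det := by
    rw [integral_finsetSum _ fun τ _ => hint σ τ]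
    have hσ : ((Equiv.Perm.sign σ : ℤ) : 𝕜) * ((Equiv.Perm.sign σ : ℤ) : 𝕜) = 1 := by
      exact_mod_cast Int.units_coe_mul_self (Equiv.Perm.sign σ)
    have hperm : A.det = ((Equiv.Perm.sign σ : ℤ) : 𝕜) * (A.submatrix σ id).transpose.det := by
      rw [Matrix.det_transpose, Matrix.det_permute, ← mul_assoc, hσ, one_mul]
    rw [hperm, Matrix.det_apply', Finset.mul_sum]
    refine Finset.sum_congr rfl fun τ _ => ?_
    rw [integral_const_mul,
      integral_fintype_prod_eq_prod (fun j y => f (σ j) y * g (τ j) y), mul_assoc]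
    rfl
  rw [Finset.sum_congr rfl fun σ _ => hterm σ]
  simp [Fintype.card_perm]

theorem det_vandermonde_eq_prod_filter {R : Type*} [CommRing R] {n : ℕ} (v : Fin n → R) :
    (Matrix.vandermonde v).det
      = ∏ p ∈ Finset.univ.filter (fun p : Fin n × Fin n => p.1 < p.2), (v p.2 - v p.1) := by
  rw [Matrix.det_vandermonde]
  symm
  exact Finset.prod_finset_product' _ _ _ (by simp) (f := fun i j => v j - v i)

/-- the Gaussian eigenvalue-side computation from the Appendix of the
paper, determining the Harish-Chandra normalization constant. -/
theorem stmt_9 (n : ℕ) (hn : 1 ≤ n) (lam : Fin n → ℂ) :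
    (∫ x : Fin n → ℝ,
        ((∏ p ∈ Finset.univ.filter (fun p : Fin n × Fin n => p.1 < p.2),
            (x p.2 - x p.1) : ℝ) : ℂ) *
        Matrix.det (Matrix.of fun j k : Fin n => Complex.exp ((x j : ℂ) * lam k)) *
        ∏ j, (Real.exp (-(x j) ^ 2 / 2) : ℂ))
      = (n.factorial : ℂ) * (((2 * Real.pi) ^ ((n : ℝ) / 2) : ℝ) : ℂ) *
        Complex.exp ((1 / 2) * ∑ ℓ, lam ℓ ^ 2) *
        ∏ p ∈ Finset.univ.filter (fun p : Fin n × Fin n => p.1 < p.2),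
          (lam p.2 - lam p.1) := by
  choose p hmonic hdeg hmoment using exists_monic_integral_pow_mul_cexp_sub_sq_div_two
  have hintegrand (x : Fin n → ℝ) :
      ((∏ p ∈ Finset.univ.filter (fun p : Fin n × Fin n => p.1 < p.2),
            (x p.2 - x p.1) : ℝ) : ℂ) *
        Matrix.det (Matrix.of fun j k : Fin n => Complex.exp ((x j : ℂ) * lam k)) *
        ∏ j, (Real.exp (-(x j) ^ 2 / 2) : ℂ)
      = (Matrix.of fun j k : Fin n => (x j : ℂ) ^ (k : ℕ)).det *
        (Matrix.of fun j k : Fin n => Complex.exp (x j * lam k - x j ^ 2 / 2)).det := by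
    have h1 : ((∏ p ∈ Finset.univ.filter (fun p : Fin n × Fin n => p.1 < p.2),
        (x p.2 - x p.1) : ℝ) : ℂ) = (Matrix.of fun j k : Fin n => (x j : ℂ) ^ (k : ℕ)).det := by
      push_cast
      exact (det_vandermonde_eq_prod_filter fun j => (x j : ℂ)).symm
    have h2 := Matrix.det_mul_column (fun j => (Real.exp (-(x j) ^ 2 / 2) : ℂ))
      (Matrix.of fun j k : Fin n => Complex.exp ((x j : ℂ) * lam k))
    rw [h1, mul_assoc, mul_comm (Matrix.det _) (∏ j, _), ← h2]
    congr 3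
    ext j k
    simp only [Matrix.of_apply, Complex.ofReal_exp, ← Complex.exp_add]
    push_cast
    ring_nf
  simp_rw [hintegrand]
  have hA := integral_det_mul_det (volume : Measure ℝ) (fun k : Fin n => fun x => (x : ℂ) ^ (k : ℕ))
    (fun k x => Complex.exp (x * lam k - x ^ 2 / 2))
    fun i j => integrable_pow_mul_cexp_sub_sq_div_two i (lam j)
  rw [volume_pi, hA, Fintype.card_fin]
  simp_rw [hmoment]
  have hdet := Matrix.det_mul_row
    (fun j => (Real.sqrt (2 * Real.pi) : ℂ) * Complex.exp (lam j ^ 2 / 2))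
    (Matrix.of fun i j : Fin n => (p i).eval (lam j))
  have hV : (Matrix.of fun i j : Fin n => (p i).eval (lam j)).det
      = (Matrix.vandermonde lam).det := by
    rw [Matrix.det_eval_matrixOfPolynomials_eq_det_vandermonde lam (fun i => p i)
      (fun i => hdeg i) (fun i => hmonic i), ← Matrix.det_transpose]
    rfl
  have hsqrt : ((((2 * Real.pi) ^ ((n : ℝ) / 2) : ℝ)) : ℂ) = (Real.sqrt (2 * Real.pi) : ℂ) ^ n := by
    rw [← Complex.ofReal_pow, Real.sqrt_eq_rpow, ← Real.rpow_natCast,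
      ← Real.rpow_mul (by positivity)]
    ring_nf
  simp only [Matrix.of_apply] at hdet
  rw [hdet, hV, det_vandermonde_eq_prod_filter, Finset.prod_mul_distrib, ← Complex.exp_sum, hsqrt,
    Finset.prod_const, Finset.card_univ, Fintype.card_fin, ← Finset.sum_div]
  ring_nf
end

section
/- Let n ≥ 1 and let λ_1,…,λ_n be complex numbers. Then det[ ∫_ℝ e^{−x²/2 + λ_ℓ x} x^{k−1} dx ]_{ℓ,k=1}^n = (2π)^{n/2} · e^{(1/2) Σ_{ℓ=1}^n λ_ℓ²} · ∏_{1≤ℓ<m≤n} (λ_m − λ_ℓ). -/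
open Finset MeasureTheory

/-- The polynomials `P k` with `∫ x ^ k * exp (z * x) = exp (z ^ 2 / 2) * P k z` against the
standard Gaussian measure. -/
noncomputable def gaussianMomentPoly : ℕ → Polynomial ℂ
  | 0 => 1
  | k + 1 => Polynomial.X * gaussianMomentPoly k + Polynomial.derivative (gaussianMomentPoly k)

lemma gaussianMomentPoly_monic_and_natDegree (k : ℕ) :
    (gaussianMomentPoly k).Monic ∧ (gaussianMomentPoly k).natDegree = k := by
  induction k with
  | zero => simp [gaussianMomentPoly]
  | succ k ih =>
    obtain ⟨hmonic, hdeg⟩ := ih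
    have hX : (Polynomial.X * gaussianMomentPoly k).natDegree = k + 1 := by
      rw [Polynomial.natDegree_X_mul hmonic.ne_zero, hdeg]
    have hlt : (Polynomial.derivative (gaussianMomentPoly k)).natDegree <
        (Polynomial.X * gaussianMomentPoly k).natDegree := by
      have := Polynomial.natDegree_derivative_le (gaussianMomentPoly k)
      omega
    exact ⟨(Polynomial.monic_X.mul hmonic).add_of_left
      (Polynomial.degree_lt_degree hlt),
      (Polynomial.natDegree_add_eq_left_of_natDegree_lt hlt).trans hX⟩

lemma integral_pow_mul_cexp_gaussianReal (k : ℕ) (z : ℂ) :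
    ∫ x : ℝ, (x : ℂ) ^ k * Complex.exp (z * x) ∂(ProbabilityTheory.gaussianReal 0 1) =
      Complex.exp (z ^ 2 / 2) * (gaussianMomentPoly k).eval z := by
  induction k generalizing z with
  | zero =>
    simpa [ProbabilityTheory.complexMGF, gaussianMomentPoly] using
      ProbabilityTheory.complexMGF_id_gaussianReal (μ := 0) (v := 1) z
  | succ k ih =>
    have hleft := ProbabilityTheory.hasDerivAt_integral_pow_mul_exp (X := id)
      (μ := ProbabilityTheory.gaussianReal 0 1) (z := z) (by simp) k
    simp only [id_eq, ih] at hleft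
    have hsq : HasDerivAt (fun w : ℂ => w ^ 2 / 2) z z := by
      simpa using (hasDerivAt_pow 2 z).div_const 2
    have hright := hsq.cexp.mul ((gaussianMomentPoly k).hasDerivAt z)
    rw [hleft.unique hright]
    simp only [gaussianMomentPoly, Polynomial.eval_add, Polynomial.eval_mul, Polynomial.eval_X]
    ring

lemma integral_cexp_neg_sq_div_two_add_mul_pow (k : ℕ) (z : ℂ) :
    ∫ x : ℝ, Complex.exp (-(x : ℂ) ^ 2 / 2 + z * (x : ℂ)) * (x : ℂ) ^ k =
      (√(2 * Real.pi) : ℂ) * Complex.exp (z ^ 2 / 2) * (gaussianMomentPoly k).eval z := by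
  have hpi : (√(2 * Real.pi) : ℂ) ≠ 0 := by
    exact_mod_cast (Real.sqrt_pos.2 (by positivity)).ne'
  rw [mul_assoc, ← integral_pow_mul_cexp_gaussianReal,
    ProbabilityTheory.integral_gaussianReal_eq_integral_smul one_ne_zero, ← integral_const_mul]
  congr with x
  simp only [ProbabilityTheory.gaussianPDFReal, Complex.real_smul, Complex.exp_add]
  push_cast
  simp only [sub_zero, mul_one]
  field_simp

/-- the determinant of Gaussian moment integrals
(intermediate step in the Appendix of the paper). -/
theorem stmt_10 (n : ℕ) (hn : 1 ≤ n) (lam : Fin n → ℂ) :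
    Matrix.det (Matrix.of fun ℓ k : Fin n =>
        ∫ x : ℝ, Complex.exp (-(x : ℂ) ^ 2 / 2 + lam ℓ * (x : ℂ)) * (x : ℂ) ^ (k : ℕ))
      = (((2 * Real.pi) ^ ((n : ℝ) / 2) : ℝ) : ℂ) *
        Complex.exp ((1 / 2) * ∑ ℓ, lam ℓ ^ 2) *
        ∏ p ∈ Finset.univ.filter (fun p : Fin n × Fin n => p.1 < p.2),
          (lam p.2 - lam p.1) := by
  have hpow : (2 * Real.pi) ^ ((n : ℝ) / 2) = √(2 * Real.pi) ^ n := by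
    rw [Real.sqrt_eq_rpow, ← Real.rpow_mul_natCast (by positivity)]
    ring_nf
  have hprod : ∏ p ∈ Finset.univ.filter (fun p : Fin n × Fin n => p.1 < p.2),
      (lam p.2 - lam p.1) = (Matrix.vandermonde lam).det := by
    rw [Matrix.det_vandermonde]
    exact Finset.prod_finset_product _ _ _ (by simp)
  simp only [integral_cexp_neg_sq_div_two_add_mul_pow]
  rw [hprod, Matrix.det_eval_matrixOfPolynomials_eq_det_vandermonde lam
    (fun i => gaussianMomentPoly i) (fun i => (gaussianMomentPoly_monic_and_natDegree i).2)
    (fun i => (gaussianMomentPoly_monic_and_natDegree i).1), hpow]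
  refine (Matrix.det_mul_column (fun ℓ => (√(2 * Real.pi) : ℂ) * Complex.exp (lam ℓ ^ 2 / 2))
    (Matrix.of fun i j : Fin n => (gaussianMomentPoly j).eval (lam i))).trans ?_
  rw [Finset.prod_mul_distrib, ← Complex.exp_sum, ← Finset.sum_div]
  simp [div_eq_inv_mul]
end

section
/- Let w, (p_k), (h_k) and the Cauchy transforms q̂_k be as in the context. Then for every n ≥ 1 and every z ∈ ℂ \ ℝ one has p_{n−1}(z) · q̂_n(z) − p_n(z) · q̂_{n−1}(z) = h_{n−1}. -/
open MeasureTheory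

/-- The Cauchy transform `q̂_k(z) = ∫_ℝ p_k(x) w(x)/(x - z) dx`. -/
noncomputable def qhat (w : ℝ → ℝ) (p : ℕ → Polynomial ℝ) (k : ℕ) (z : ℂ) : ℂ :=
  ∫ x : ℝ, (((p k).eval x * w x : ℝ) : ℂ) / ((x : ℂ) - z)

open Polynomial in
theorem integrable_eval_mul_weight {w : ℝ → ℝ} (hw_meas : Measurable w)
    (hw_moments : ∀ k : ℕ, Integrable (fun x : ℝ => |x| ^ k * w x)) (Q : ℂ[X]) :
    Integrable (fun x : ℝ => Q.eval (x : ℂ) * (w x : ℂ)) := by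
  induction Q using Polynomial.induction_on' with
  | add P Q hP hQ => simpa [add_mul, Pi.add_def] using hP.add hQ
  | monomial k a =>
    have hk : Integrable (fun x : ℝ => (x : ℂ) ^ k * (w x : ℂ)) := by
      refine (hw_moments k).mono (by fun_prop) (Filter.Eventually.of_forall fun x => ?_)
      simp
    simpa [mul_assoc] using hk.const_mul a

theorem norm_inv_ofReal_sub_le (x : ℝ) {z : ℂ} (hz : z.im ≠ 0) :
    ‖((x : ℂ) - z)⁻¹‖ ≤ |z.im|⁻¹ := by
  rw [norm_inv]
  refine inv_anti₀ (abs_pos.mpr hz) ?_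
  simpa using Complex.abs_im_le_norm ((x : ℂ) - z)

open Polynomial in
theorem integrable_eval_mul_weight_div {w : ℝ → ℝ} (hw_meas : Measurable w)
    (hw_moments : ∀ k : ℕ, Integrable (fun x : ℝ => |x| ^ k * w x)) (Q : ℂ[X])
    {z : ℂ} (hz : z.im ≠ 0) :
    Integrable (fun x : ℝ => Q.eval (x : ℂ) * (w x : ℂ) / ((x : ℂ) - z)) := by
  simp only [div_eq_mul_inv]
  exact (integrable_eval_mul_weight hw_meas hw_moments Q).mul_bdd
    (c := |z.im|⁻¹) (by fun_prop)
    (Filter.Eventually.of_forall fun x => norm_inv_ofReal_sub_le x hz)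

theorem eval_map_ofReal (P : Polynomial ℝ) (x : ℝ) :
    (P.map Complex.ofRealHom).eval (x : ℂ) = ((P.eval x : ℝ) : ℂ) := by
  simpa using Polynomial.eval_map_apply (f := Complex.ofRealHom) (p := P) x

open Polynomial in
/-- An orthogonal polynomial annihilates all complex polynomials of smaller degree. -/
theorem integral_eval_mul_orthogonal_eq_zero {w : ℝ → ℝ} (hw_meas : Measurable w)
    (hw_moments : ∀ k : ℕ, Integrable (fun x : ℝ => |x| ^ k * w x))
    {p : ℕ → ℝ[X]} (hp_monic : ∀ k, (p k).Monic) (hp_deg : ∀ k, (p k).natDegree = k)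
    (hp_orth : ∀ j k, j ≠ k → ∫ x : ℝ, (p j).eval x * (p k).eval x * w x = 0)
    {k m : ℕ} (hmk : m ≤ k) {Q : ℂ[X]} (hQ : Q.degree < m) :
    ∫ x : ℝ, (Q * (p k).map Complex.ofRealHom).eval (x : ℂ) * (w x : ℂ) = 0 := by
  induction m generalizing Q with
  | zero =>
    have : Q = 0 := by simpa using hQ
    simp [this]
  | succ m ih =>
    set P := (p m).map Complex.ofRealHom with hP
    have hPm : P.Monic := (hp_monic m).map _
    have hPd : P.natDegree = m := by rw [hP, (hp_monic m).natDegree_map, hp_deg]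
    set R := Q - C (Q.coeff m) * P with hR
    have hRd : R.degree < m := by
      rw [degree_lt_iff_coeff_zero]
      intro i hi
      rcases hi.eq_or_lt with rfl | hi
      · have : P.coeff m = 1 := by simpa [hPd] using hPm.coeff_natDegree
        simp [hR, this]
      · have h1 : Q.coeff i = 0 := (degree_lt_iff_coeff_zero Q (m + 1)).mp hQ i hi
        have h2 : P.coeff i = 0 := coeff_eq_zero_of_natDegree_lt (by omega)
        simp [hR, h1, h2]
    have hPk : ∫ x : ℝ, (P * (p k).map Complex.ofRealHom).eval (x : ℂ) * (w x : ℂ) = 0 := by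
      simp only [hP, eval_mul, eval_map_ofReal, ← Complex.ofReal_mul]
      rw [integral_complex_ofReal, hp_orth m k (by omega), Complex.ofReal_zero]
    have hsplit : ∀ x : ℝ, (Q * (p k).map Complex.ofRealHom).eval (x : ℂ) * (w x : ℂ) =
        (R * (p k).map Complex.ofRealHom).eval (x : ℂ) * (w x : ℂ) +
        Q.coeff m * ((P * (p k).map Complex.ofRealHom).eval (x : ℂ) * (w x : ℂ)) := by
      intro x
      simp only [hR, eval_mul, eval_sub, eval_C]
      ring
    have hint := integrable_eval_mul_weight hw_meas hw_moments
    simp_rw [hsplit]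
    rw [integral_add (hint _) ((hint _).const_mul _), integral_const_mul, hPk,
      ih (by omega) hRd, mul_zero, add_zero]

/-- `p_{n-1}(z) q̂_n(z) - p_n(z) q̂_{n-1}(z) = h_{n-1}`, i.e. the
Fokas–Its–Kitaev Riemann–Hilbert matrix has determinant one. -/
theorem stmt_12 (w : ℝ → ℝ) (hw_meas : Measurable w) (hw_nonneg : ∀ x, 0 ≤ w x)
    (hw_moments : ∀ k : ℕ, Integrable (fun x : ℝ => |x| ^ k * w x))
    (hw_pos : 0 < ∫ x : ℝ, w x)
    (p : ℕ → Polynomial ℝ) (hp_monic : ∀ k, (p k).Monic)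
    (hp_deg : ∀ k, (p k).natDegree = k)
    (hp_orth : ∀ j k, j ≠ k → ∫ x : ℝ, (p j).eval x * (p k).eval x * w x = 0)
    (h : ℕ → ℝ) (hh : ∀ k, h k = ∫ x : ℝ, ((p k).eval x) ^ 2 * w x)
    (hh_pos : ∀ k, 0 < h k)
    (n : ℕ) (hn : 1 ≤ n) (z : ℂ) (hz : z.im ≠ 0) :
    (Polynomial.aeval z) (p (n - 1)) * qhat w p n z -
      (Polynomial.aeval z) (p n) * qhat w p (n - 1) z = (h (n - 1) : ℂ) := by
  obtain ⟨m, rfl⟩ : ∃ m, n = m + 1 := ⟨n - 1, by omega⟩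
  rw [Nat.add_sub_cancel]
  set P : ℕ → Polynomial ℂ := fun k => (p k).map Complex.ofRealHom with hP
  set D : ℕ → Polynomial ℂ := fun k => P k /ₘ (Polynomial.X - Polynomial.C z) with hD
  have hPm : ∀ k, (P k).Monic := fun k => (hp_monic k).map _
  have hPd : ∀ k, (P k).natDegree = k := fun k => by
    rw [hP, (hp_monic k).natDegree_map, hp_deg]
  have hPdeg : ∀ k, (P k).degree = k := fun k => by
    rw [Polynomial.degree_eq_natDegree (hPm k).ne_zero, hPd]
  have hdiv : ∀ k (y : ℂ), (P k).eval y = (y - z) * (D k).eval y + (P k).eval z := by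
    intro k y
    have := congrArg (Polynomial.eval y)
      (Polynomial.modByMonic_add_div (P k) (Polynomial.X - Polynomial.C z))
    rw [Polynomial.modByMonic_X_sub_C_eq_C_eval] at this
    simp only [Polynomial.eval_add, Polynomial.eval_mul, Polynomial.eval_sub, Polynomial.eval_C,
      Polynomial.eval_X] at this
    rw [← this]
    ring
  have hDm : (D (m + 1)).Monic := by
    refine (Polynomial.leadingCoeff_divByMonic_of_monic (Polynomial.monic_X_sub_C z) ?_).trans
      (hPm (m + 1))
    rw [Polynomial.degree_X_sub_C, hPdeg]
    exact_mod_cast Nat.le_add_left 1 m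
  have hDd : (D (m + 1)).degree = m := by
    rw [Polynomial.degree_eq_natDegree hDm.ne_zero,
      Polynomial.natDegree_divByMonic _ (Polynomial.monic_X_sub_C z), hPd,
      Polynomial.natDegree_X_sub_C, Nat.add_sub_cancel]
  have hlower : (D (m + 1) - P m).degree < m := by
    rw [← hDd]
    exact Polynomial.degree_sub_lt_left (hDd.trans (hPdeg m).symm) hDm.ne_zero
      (hDm.leadingCoeff.trans (hPm m).leadingCoeff.symm)
  have hDm_lt : (D m).degree < (m + 1 : ℕ) := by
    refine (Polynomial.degree_divByMonic_le _ _).trans_lt ?_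
    rw [hPdeg]
    exact_mod_cast Nat.lt_succ_self m
  have hzero : ∀ {k j : ℕ} (_ : j ≤ k) {Q : Polynomial ℂ} (_ : Q.degree < j),
      ∫ x : ℝ, (Q * P k).eval (x : ℂ) * (w x : ℂ) = 0 :=
    integral_eval_mul_orthogonal_eq_zero hw_meas hw_moments hp_monic hp_deg hp_orth
  have hsq : ∫ x : ℝ, (P m * P m).eval (x : ℂ) * (w x : ℂ) = (h m : ℂ) := by
    simp only [hP, Polynomial.eval_mul, eval_map_ofReal, ← Complex.ofReal_mul]
    rw [integral_complex_ofReal, hh]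
    simp only [sq]
  have hint := integrable_eval_mul_weight hw_meas hw_moments
  have hintz := fun Q => integrable_eval_mul_weight_div hw_meas hw_moments Q hz
  have hq : ∀ k, qhat w p k z = ∫ x : ℝ, (P k).eval (x : ℂ) * (w x : ℂ) / ((x : ℂ) - z) := by
    intro k
    simp only [qhat, hP, eval_map_ofReal, Complex.ofReal_mul]
  have haeval : ∀ k, Polynomial.aeval z (p k) = (P k).eval z := fun k =>
    (Polynomial.eval_map_algebraMap (p k) z).symm
  have hpt : ∀ x : ℝ,
      (P m).eval z * ((P (m + 1)).eval (x : ℂ) * (w x : ℂ) / ((x : ℂ) - z)) -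
        (P (m + 1)).eval z * ((P m).eval (x : ℂ) * (w x : ℂ) / ((x : ℂ) - z)) =
      ((D (m + 1) - P m) * P m).eval (x : ℂ) * (w x : ℂ) +
        (P m * P m).eval (x : ℂ) * (w x : ℂ) -
        (D m * P (m + 1)).eval (x : ℂ) * (w x : ℂ) := by
    intro x
    have hx : (x : ℂ) - z ≠ 0 := fun h0 => hz (by simpa using congrArg Complex.im h0)
    simp only [Polynomial.eval_mul, Polynomial.eval_sub]
    field_simp
    linear_combination (P m).eval (x : ℂ) * (w x : ℂ) * hdiv (m + 1) x -
      (P (m + 1)).eval (x : ℂ) * (w x : ℂ) * hdiv m x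
  rw [haeval, haeval, hq, hq, ← integral_const_mul, ← integral_const_mul,
    ← integral_sub ((hintz _).const_mul _) ((hintz _).const_mul _)]
  simp_rw [hpt]
  rw [integral_sub (by exact (hint _).add (hint _)) (hint _), integral_add (hint _) (hint _),
    hzero le_rfl hlower, hsq, hzero le_rfl hDm_lt, zero_add, sub_zero]
end
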